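/- arXiv:2403.05324 — 7 statements merged into one kernel-verified Lean document; each statement's English description precedes it below -/
import Mathlib

section
/- Let f ∈ ℂ[x,y] be a squarefree (reduced) polynomial, written f = Σ_{i=0}^n f_i(x)·y^i with f_i ∈ ℂ[x], n = deg_y f, and f₀ ≠ 0, f_n ≠ 0. Then the following are equivalent: (A) f is quasi-homogeneous with the weight of x nonzero, i.e. there exist integers w, α, β with α ≠ 0 such that α·i + β·j = w for every monomial x^i y^j appearing in f with nonzero coefficient; (B) f₀ and f_n are nonzero monomials in x, and for every a ∈ ℂ with a ≠ 0 the univariate polynomial f(a, y) ∈ ℂ[y] has no repeated root (equivalently, the discriminant Disc_y(f) ∈ ℂ[x] is a nonzero monomial). -/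
open Polynomial

/-- Evaluation of a bivariate polynomial `f ∈ ℂ[x][y]` at the point `(a, b)`
(with `x` the inner variable and `y` the outer one). -/
noncomputable def evalXY (a b : ℂ) (f : Polynomial (Polynomial ℂ)) : ℂ :=
  (f.map (evalRingHom a)).eval b

/-- A univariate polynomial is a nonzero monomial. -/
def IsNonzeroMonomial (p : Polynomial ℂ) : Prop :=
  ∃ (c : ℂ) (k : ℕ), c ≠ 0 ∧ p = C c * X ^ k

open Topology in
/-- A point of a plane curve where the partial derivative in the second variable does not vanish
has a neighbourhood projecting homeomorphically to the first variable. -/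
theorem exists_openPartialHomeomorph_fst {P : ℂ × ℂ → ℂ} (hP : ContDiff ℂ 1 P)
    (e : {p // P p = 0}) (he : fderiv ℂ P e (0, 1) ≠ 0) :
    ∃ φ : OpenPartialHomeomorph {p // P p = 0} ℂ, e ∈ φ.source ∧ ⇑φ = fun q ↦ q.1.1 := by
  classical
  have hst : HasStrictFDerivAt P (fderiv ℂ P e) e := hP.contDiffAt.hasStrictFDerivAt (by norm_num)
  have hΦ : HasStrictFDerivAt (fun p : ℂ × ℂ ↦ (p.1, P p))
      ((ContinuousLinearMap.fst ℂ ℂ ℂ).prod (fderiv ℂ P e)) e :=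
    hasStrictFDerivAt_fst.prodMk hst
  have hker : ((ContinuousLinearMap.fst ℂ ℂ ℂ).prod (fderiv ℂ P e)).toLinearMap.ker = ⊥ := by
    refine LinearMap.ker_eq_bot'.2 ?_
    rintro ⟨u, v⟩ h
    simp only [ContinuousLinearMap.coe_coe, ContinuousLinearMap.prod_apply,
      ContinuousLinearMap.coe_fst', Prod.mk_eq_zero] at h
    obtain ⟨rfl, h⟩ := h
    have : ((0 : ℂ), v) = v • ((0 : ℂ), (1 : ℂ)) := by simp
    rw [this, map_smul, smul_eq_mul] at h
    simp [(mul_eq_zero.1 h).resolve_right he]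
  let L : (ℂ × ℂ) ≃L[ℂ] ℂ × ℂ := (LinearEquiv.ofInjectiveEndo _
    (LinearMap.ker_eq_bot.1 hker)).toContinuousLinearEquiv
  have hL : (L : (ℂ × ℂ) →L[ℂ] ℂ × ℂ) = (ContinuousLinearMap.fst ℂ ℂ ℂ).prod (fderiv ℂ P e) := by
    ext <;> rfl
  rw [← hL] at hΦ
  let ψ := hΦ.toOpenPartialHomeomorph
  have hψ : ∀ p, ψ p = (p.1, P p) := fun p ↦ congrFun (hΦ.toOpenPartialHomeomorph_coe) p
  have hψs : ∀ z, (z, (0 : ℂ)) ∈ ψ.target →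
      (ψ.symm (z, 0)).1 = z ∧ P (ψ.symm (z, 0)) = 0 := fun z hz ↦ by
    have := ψ.right_inv hz
    rw [hψ] at this
    simpa using this
  refine ⟨{ toFun := fun q ↦ q.1.1
            invFun := fun z ↦ if h : P (ψ.symm (z, 0)) = 0 then ⟨_, h⟩ else e
            source := Subtype.val ⁻¹' ψ.source
            target := (fun z ↦ (z, (0 : ℂ))) ⁻¹' ψ.target
            map_source' := ?_
            map_target' := ?_
            left_inv' := ?_
            right_inv' := ?_
            open_source := ψ.open_source.preimage continuous_subtype_val
            open_target := ψ.open_target.preimage (by fun_prop)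
            continuousOn_toFun := by fun_prop
            continuousOn_invFun := ?_ }, ?_, rfl⟩
  · rintro ⟨p, hp⟩ hps
    have := ψ.map_source hps
    rwa [hψ, hp] at this
  · intro z hz
    simpa [(hψs z hz).2] using ψ.map_target hz
  · rintro ⟨p, hp⟩ hps
    have h1 := ψ.left_inv hps
    rw [hψ, hp] at h1
    have h2 : P (ψ.symm (p.1, 0)) = 0 := by rw [h1, hp]
    simp only [h2, dite_true]
    exact Subtype.ext h1
  · intro z hz
    simp [(hψs z hz).2, (hψs z hz).1]
  · refine (IsInducing.subtypeVal (t := {p | P p = 0})).continuousOn_iff.2 ?_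
    refine (ψ.continuousOn_symm.comp (t := ψ.target) (f := fun z ↦ (z, (0 : ℂ)))
      (by fun_prop) fun z hz ↦ hz).congr fun z hz ↦ ?_
    simp [(hψs z hz).2]
  · exact hΦ.mem_toOpenPartialHomeomorph_source

/-- A plane curve that is smooth over the first coordinate and whose fibres are locally uniformly
bounded covers the line. -/
theorem isCoveringMap_fst_of_fderiv_ne_zero {P : ℂ × ℂ → ℂ} (hP : ContDiff ℂ 1 P)
    (hP' : ∀ p, P p = 0 → fderiv ℂ P p (0, 1) ≠ 0) {B : ℂ → ℝ} (hB : Continuous B)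
    (hPB : ∀ p, P p = 0 → ‖p.2‖ ≤ B p.1) :
    IsCoveringMap fun q : {p // P p = 0} ↦ q.1.1 := by
  have hφ := fun e : {p // P p = 0} ↦ exists_openPartialHomeomorph_fst hP e (hP' e e.2)
  have hcl : IsClosed {p | P p = 0} := isClosed_eq hP.continuous continuous_const
  have hproper : IsProperMap fun q : {p // P p = 0} ↦ q.1.1 := by
    refine isProperMap_iff_isCompact_preimage.2 ⟨by fun_prop, fun K hK ↦ ?_⟩
    rw [Subtype.isCompact_iff]
    obtain ⟨b, hb⟩ := (hK.image hB).bddAbove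
    refine (hK.prod (isCompact_closedBall (0 : ℂ) b)).of_isClosed_subset ?_ ?_
    · convert hcl.inter (hK.isClosed.preimage continuous_fst) using 1
      ext p
      simp [and_comm]
    · rintro _ ⟨⟨p, hp⟩, hpK, rfl⟩
      exact ⟨hpK, mem_closedBall_zero_iff.2 ((hPB p hp).trans (hb ⟨_, hpK, rfl⟩))⟩
  rw [isCoveringMap_iff_isCoveringMapOn_univ]
  refine hproper.isClosedMap.isCoveringMapOn_of_isLocalHomeomorphOn (fun z _ ↦ ?_) fun e _ ↦ ?_
  · refine (hproper.isCompact_preimage isCompact_singleton).finite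
      (.of_openPartialHomeomorph _ subset_rfl fun e _ ↦ hφ e)
  · obtain ⟨φ, h1, h2⟩ := hφ e
    exact ⟨φ, h1, h2.symm⟩

open Topology in
/-- A continuous section of a plane curve that is smooth over the first coordinate is
holomorphic. -/
theorem differentiable_of_curve_section {P : ℂ × ℂ → ℂ} (hP : ContDiff ℂ 1 P)
    (hP' : ∀ p, P p = 0 → fderiv ℂ P p (0, 1) ≠ 0) {Y : ℂ → ℂ} (hY : Continuous Y)
    (hPY : ∀ z, P (z, Y z) = 0) : Differentiable ℂ Y := by
  intro z
  have hst : HasStrictFDerivAt P (fderiv ℂ P (z, Y z)) (z, Y z) :=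
    hP.contDiffAt.hasStrictFDerivAt (by norm_num)
  have hinv : (fderiv ℂ P (z, Y z) ∘L .inr ℂ ℂ ℂ).IsInvertible := by
    have hne := hP' _ (hPY z)
    refine ⟨ContinuousLinearEquiv.unitsEquivAut ℂ (Units.mk0 _ hne), ?_⟩
    ext
    simp
  have hev := hst.eventually_apply_eq_iff_implicitFunctionOfProdDomain hinv
  have hd := (hst.hasStrictFDerivAt_implicitFunctionOfProdDomain hinv).hasFDerivAt.differentiableAt
  refine hd.congr_of_eventuallyEq ?_
  have hcont : Filter.Tendsto (fun w ↦ (w, Y w)) (𝓝 z) (𝓝 (z, Y z)) :=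
    (continuous_id.prodMk hY).tendsto z
  filter_upwards [hcont.eventually hev] with w hw
  exact (hw.1 ((hPY w).trans (hPY z).symm)).symm

/-- Through every point of such a curve passes exactly one global continuous section. -/
theorem existsUnique_curve_section {P : ℂ × ℂ → ℂ} (hP : ContDiff ℂ 1 P)
    (hP' : ∀ p, P p = 0 → fderiv ℂ P p (0, 1) ≠ 0) {B : ℂ → ℝ} (hB : Continuous B)
    (hPB : ∀ p, P p = 0 → ‖p.2‖ ≤ B p.1) {a b : ℂ} (hab : P (a, b) = 0) :
    ∃! Y : C(ℂ, ℂ), Y a = b ∧ ∀ z, P (z, Y z) = 0 := by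
  obtain ⟨F, ⟨hFa, hF⟩, huniq⟩ :=
    (isCoveringMap_fst_of_fderiv_ne_zero hP hP' hB hPB).existsUnique_continuousMap_lifts
      (.id ℂ) a ⟨(a, b), hab⟩ rfl
  have hF1 : ∀ z, (F z).1.1 = z := fun z ↦ congrFun hF z
  refine ⟨⟨fun z ↦ (F z).1.2, by fun_prop⟩, ⟨by simp [hFa], fun z ↦ ?_⟩, fun Y hY ↦ ?_⟩
  · have := (F z).2
    rwa [← Prod.mk.eta (p := (F z).1), hF1] at this
  · have := huniq ⟨fun z ↦ ⟨(z, Y z), hY.2 z⟩, by fun_prop⟩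
      ⟨Subtype.ext (by simp [hY.1]), rfl⟩
    ext z
    simp [← this]

/-- An entire function whose real part grows at most linearly has constant derivative. -/
theorem deriv_const_of_re_le_linear {h : ℂ → ℂ} (hd : Differentiable ℂ h) {A M : ℝ}
    (hre : ∀ z, (h z).re ≤ A + M * ‖z‖) : ∃ m, ∀ z, deriv h z = m := by
  obtain ⟨B, hB, hBre⟩ : ∃ B : ℝ, 0 < B ∧ ∀ z, (h z).re ≤ B * (1 + ‖z‖) := by
    refine ⟨|A| + |M| + 1, by positivity, fun z ↦ (hre z).trans ?_⟩
    nlinarith [le_abs_self A, le_abs_self M, norm_nonneg z, abs_nonneg A, abs_nonneg M,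
      mul_nonneg (abs_nonneg A) (norm_nonneg z),
      mul_le_mul_of_nonneg_right (le_abs_self M) (norm_nonneg z)]
  have hgrowth : ∀ z, ‖h z‖ ≤ (6 * B + 3 * ‖h 0‖) * (1 + ‖z‖) := by
    intro z
    have hz := norm_nonneg z
    have hbc := Complex.borelCaratheodory (f := h) (M := B * (1 + 2 * (1 + ‖z‖))) (R := 2 * (1 + ‖z‖))
      (z := z) (by positivity) hd.differentiableOn (fun w hw ↦ ?_) (by positivity)
      (by rw [mem_ball_zero_iff]; linarith)
    · refine hbc.trans ?_
      have h0 := norm_nonneg (h 0)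
      have hden : 2 * (1 + ‖z‖) - ‖z‖ = 2 + ‖z‖ := by ring
      rw [hden, ← add_div, div_le_iff₀ (by positivity)]
      have := mul_nonneg hB.le hz
      have := mul_nonneg this hz
      have := mul_nonneg h0 hz
      have := mul_nonneg this hz
      nlinarith
    · rw [mem_ball_zero_iff] at hw
      refine (hBre w).trans ?_
      gcongr
  have hbd : ∀ z, ‖deriv h z‖ ≤ (6 * B + 3 * ‖h 0‖) * 2 := by
    intro z
    have hz := norm_nonneg z
    have hK : 0 ≤ 6 * B + 3 * ‖h 0‖ := by positivity
    have := Complex.norm_deriv_le_of_forall_mem_sphere_norm_le (f := h) (c := z)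
      (R := 1 + ‖z‖) (C := (6 * B + 3 * ‖h 0‖) * (2 * (1 + ‖z‖))) (by positivity)
      hd.diffContOnCl fun w hw ↦ (hgrowth w).trans ?_
    · refine this.trans_eq ?_
      field_simp
    · rw [mem_sphere_iff_norm] at hw
      gcongr
      have := norm_le_norm_add_norm_sub' w z
      linarith
  obtain ⟨m, hm⟩ := hd.deriv.exists_const_forall_eq_of_bounded
    (isBounded_iff_forall_norm_le.2 ⟨_, Set.forall_mem_range.2 hbd⟩)
  exact ⟨m, hm⟩

theorem eq_mul_exp_of_deriv_eq_mul {g : ℂ → ℂ} (hg : Differentiable ℂ g) {k : ℂ → ℂ}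
    (hk : Differentiable ℂ k) (h : ∀ z, deriv g z = deriv k z * g z) (z : ℂ) :
    g z = g 0 * Complex.exp (k z - k 0) := by
  have hconst := is_const_of_deriv_eq_zero (f := fun z ↦ g z * Complex.exp (-k z))
    (by fun_prop) (fun z ↦ by
      have h1 := (hg z).hasDerivAt.mul (hk z).hasDerivAt.neg.cexp
      refine h1.deriv.trans ?_
      rw [h z]; ring) z 0
  have := congrArg (· * Complex.exp (k z)) hconst
  simp only [mul_assoc, ← Complex.exp_add] at this
  rw [neg_add_cancel, Complex.exp_zero, mul_one] at this
  rw [this]; ring_nf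

/-- A zero-free entire function of exponential type is a multiple of an exponential. -/
theorem exists_eq_mul_exp_of_norm_le {g : ℂ → ℂ} (hg : Differentiable ℂ g) (hg0 : ∀ z, g z ≠ 0)
    {C M : ℝ} (hle : ∀ z, ‖g z‖ ≤ C * Real.exp (M * ‖z‖)) :
    ∃ m : ℂ, ∀ z, g z = g 0 * Complex.exp (m * z) := by
  obtain ⟨k, hk⟩ := (hg.deriv.div hg hg0).isExactOn_univ
  replace hk : ∀ z, HasDerivAt k (deriv g z / g z) z := fun z ↦ hk z trivial
  have hkd : Differentiable ℂ k := fun z ↦ (hk z).differentiableAt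
  have hgk := eq_mul_exp_of_deriv_eq_mul hg hkd fun z ↦ by
    rw [(hk z).deriv, div_mul_cancel₀ _ (hg0 z)]
  have hC : 0 < C := by
    have := (norm_pos_iff.2 (hg0 0)).trans_le (hle 0)
    simpa using this
  obtain ⟨m, hm⟩ := deriv_const_of_re_le_linear hkd (A := Real.log C - Real.log ‖g 0‖ + (k 0).re)
    (M := M) fun z ↦ by
      have h1 := hle z
      rw [hgk z, norm_mul, Complex.norm_exp] at h1
      have h2 := Real.log_le_log (by have := norm_pos_iff.2 (hg0 0); positivity) h1
      rw [Real.log_mul (by simpa using hg0 0) (Real.exp_ne_zero _), Real.log_exp,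
        Real.log_mul hC.ne' (Real.exp_ne_zero _), Real.log_exp, Complex.sub_re] at h2
      linarith
  refine ⟨m, fun z ↦ ?_⟩
  have := eq_mul_exp_of_deriv_eq_mul hg (k := fun z ↦ m * z) (by fun_prop)
    (fun z ↦ by
      have : deriv (fun z ↦ m * z) z = m := by simp
      rw [this, ← hm z, (hk z).deriv, div_mul_cancel₀ _ (hg0 z)]) z
  simpa using this

/-- Over a GCD domain, squarefreeness passes to the fraction field. -/
theorem squarefree_map_fractionRing {R : Type*} [CommRing R] [IsDomain R] [NormalizedGCDMonoid R]
    (K : Type*) [Field K] [Algebra R K] [IsFractionRing R K]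
    {f : R[X]} (hf : Squarefree f) : Squarefree (f.map (algebraMap R K)) := by
  intro g hg
  have hf0 : f.map (algebraMap R K) ≠ 0 :=
    (Polynomial.map_ne_zero_iff (IsFractionRing.injective R K)).2 hf.ne_zero
  have hg0 : g ≠ 0 := by
    rintro rfl
    exact hf0 (by simpa using hg)
  set N := IsLocalization.integerNormalization (nonZeroDivisors R) g with hN
  obtain ⟨c, hc, hcg⟩ := IsLocalization.integerNormalization_spec (nonZeroDivisors R) g
  have hprim := N.isPrimitive_primPart
  have hpg : N.primPart.map (algebraMap R K) ∣ g := by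
    have hc' : algebraMap R K c ≠ 0 := by
      simpa using nonZeroDivisors.ne_zero hc
    have h1 : N.primPart.map (algebraMap R K) ∣ c • g := by
      rw [← hcg]
      exact Polynomial.map_dvd _ N.primPart_dvd
    rw [Algebra.smul_def, IsScalarTower.algebraMap_apply R K K[X]] at h1
    exact (IsUnit.dvd_mul_left ((IsUnit.mk0 _ hc').map (algebraMap K K[X]))).1 h1
  have hdvd : N.primPart * N.primPart ∣ f := by
    refine (hprim.mul hprim).dvd_of_fraction_map_dvd_fraction_map (K := K) ?_
    rw [Polynomial.map_mul]
    exact (mul_dvd_mul hpg hpg).trans hg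
  exact isUnit_or_eq_zero_of_isUnit_integerNormalization_primPart hg0 (hf _ hdvd)

/-- A squarefree polynomial over a GCD domain of characteristic zero generates, together with its
derivative, an ideal containing a nonzero constant. -/
theorem exists_mul_add_mul_derivative_eq_C {R : Type*} [CommRing R] [IsDomain R]
    [NormalizedGCDMonoid R] [CharZero R] {f : R[X]} (hf : Squarefree f) :
    ∃ d : R, d ≠ 0 ∧ ∃ A B : R[X], A * f + B * derivative f = C d := by
  let K := FractionRing R
  have : CharZero K := charZero_of_injective_algebraMap (IsFractionRing.injective R K)
  have hsep : (f.map (algebraMap R K)).Separable :=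
    PerfectField.separable_iff_squarefree.2 (squarefree_map_fractionRing K hf)
  obtain ⟨a, b, hab⟩ := hsep
  obtain ⟨c, hc, hca⟩ := IsLocalization.integerNormalization_spec (nonZeroDivisors R) a
  obtain ⟨e, he, heb⟩ := IsLocalization.integerNormalization_spec (nonZeroDivisors R) b
  refine ⟨c * e, mul_ne_zero (nonZeroDivisors.ne_zero hc) (nonZeroDivisors.ne_zero he),
    C e * IsLocalization.integerNormalization (nonZeroDivisors R) a,
    C c * IsLocalization.integerNormalization (nonZeroDivisors R) b, ?_⟩
  apply Polynomial.map_injective _ (IsFractionRing.injective R K)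
  simp only [Polynomial.map_add, Polynomial.map_mul, hca, heb, map_C, Algebra.smul_def,
    ← derivative_map, IsScalarTower.algebraMap_apply R K K[X], map_mul]
  linear_combination C (algebraMap R K c) * C (algebraMap R K e) * hab

/-! ### From quasi-homogeneity to simple roots -/

theorem isNonzeroMonomial_of_support {p : ℂ[X]} (hp : p ≠ 0)
    (h : ∀ i j, p.coeff i ≠ 0 → p.coeff j ≠ 0 → i = j) : IsNonzeroMonomial p := by
  refine ⟨p.leadingCoeff, p.natDegree, leadingCoeff_ne_zero.2 hp, ?_⟩
  ext i
  rw [coeff_C_mul_X_pow]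
  split_ifs with hi
  · rw [hi, leadingCoeff]
  · by_contra hne
    exact hi (h i _ hne (leadingCoeff_ne_zero.2 hp))

theorem comp_C_mul_X_of_forall_pow_eq {f : ℂ[X][X]} {s t u : ℂ}
    (h : ∀ i j, (f.coeff j).coeff i ≠ 0 → s ^ i * t ^ j = u) (a : ℂ) :
    (f.map (evalRingHom (s * a))).comp (C t * X) = C u * f.map (evalRingHom a) := by
  ext j
  simp only [comp_C_mul_X_coeff, coeff_map, coeff_C_mul, coe_evalRingHom]
  rw [eval_eq_sum_range, eval_eq_sum_range, Finset.sum_mul, Finset.mul_sum]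
  refine Finset.sum_congr rfl fun i _ ↦ ?_
  by_cases hc : (f.coeff j).coeff i = 0
  · simp [hc]
  · rw [← h i j hc]
    ring

theorem rootMultiplicity_le_one_of_quasiHomogeneous {f : ℂ[X][X]} (hsf : Squarefree f)
    {w α β : ℤ} (hα : α ≠ 0)
    (h : ∀ i j : ℕ, (f.coeff j).coeff i ≠ 0 → α * (i : ℤ) + β * (j : ℤ) = w)
    {a : ℂ} (ha : a ≠ 0) (b : ℂ) : (f.map (evalRingHom a)).rootMultiplicity b ≤ 1 := by
  have : NormalizedGCDMonoid ℂ[X] := Classical.arbitrary _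
  obtain ⟨d, hd0, A, B, hAB⟩ := exists_mul_add_mul_derivative_eq_C hsf
  by_contra! hlt
  have hfa : f.map (evalRingHom a) ≠ 0 := by
    intro h0
    simp [h0] at hlt
  obtain ⟨hroot, hroot'⟩ := (one_lt_rootMultiplicity_iff_isRoot hfa).1 hlt
  rw [IsRoot.def] at hroot hroot'
  refine hd0 (eq_zero_of_infinite_isRoot d ?_)
  refine (Set.infinite_of_finite_compl (s := {0}ᶜ) (by simp)).mono fun x hx ↦ ?_
  have hα' : (α : ℂ) ≠ 0 := by exact_mod_cast hα
  set z := Complex.log (x / a) / α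
  have hx' : Complex.exp (α * z) * a = x := by
    rw [mul_div_cancel₀ _ hα', Complex.exp_log (div_ne_zero hx ha), div_mul_cancel₀ _ ha]
  have hcomp := comp_C_mul_X_of_forall_pow_eq (f := f) (s := Complex.exp (α * z))
    (t := Complex.exp (β * z)) (u := Complex.exp (w * z)) (fun i j hij ↦ by
      rw [← Complex.exp_nat_mul, ← Complex.exp_nat_mul, ← Complex.exp_add, ← h i j hij]
      push_cast
      ring_nf) a
  rw [hx'] at hcomp
  have h1 := congrArg (eval b) hcomp
  have h2 := congrArg (fun p ↦ eval b (derivative p)) hcomp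
  simp only [eval_comp, eval_mul, eval_C, eval_X, hroot, derivative_comp, derivative_C_mul,
    derivative_X, hroot', mul_zero, mul_one] at h1 h2
  have h2' := (mul_eq_zero.1 h2).resolve_left (Complex.exp_ne_zero _)
  have h3 := congrArg (fun p ↦ eval (Complex.exp (β * z) * b) (p.map (evalRingHom x))) hAB
  simpa [h1, h2', ← derivative_map] using h3.symm

/-! ### From simple roots to quasi-homogeneity -/

theorem exists_norm_eval_exp_le (p : ℂ[X]) :
    ∃ K D : ℝ, 0 ≤ K ∧ 0 ≤ D ∧ ∀ z, ‖p.eval (Complex.exp z)‖ ≤ K * Real.exp (D * ‖z‖) := by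
  refine ⟨∑ i ∈ Finset.range (p.natDegree + 1), ‖p.coeff i‖, p.natDegree, by positivity,
    by positivity, fun z ↦ ?_⟩
  rw [eval_eq_sum_range, Finset.sum_mul]
  refine (norm_sum_le _ _).trans (Finset.sum_le_sum fun i hi ↦ ?_)
  rw [norm_mul, ← Complex.exp_nat_mul]
  gcongr
  refine (Complex.norm_exp_le_exp_norm _).trans ?_
  rw [norm_mul, Complex.norm_natCast]
  gcongr
  exact Finset.mem_range_succ_iff.1 hi

/-- The function `(z, y) ↦ f(exp z, y)`. -/
noncomputable def evalExp (f : ℂ[X][X]) (p : ℂ × ℂ) : ℂ := evalXY (Complex.exp p.1) p.2 f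

theorem contDiff_evalExp (f : ℂ[X][X]) : ContDiff ℂ 1 (evalExp f) := by
  have : evalExp f = fun p ↦ ∑ j ∈ Finset.range (f.natDegree + 1),
      (∑ i ∈ Finset.range ((f.coeff j).natDegree + 1),
        (f.coeff j).coeff i * Complex.exp p.1 ^ i) * p.2 ^ j := by
    ext p
    rw [evalExp, evalXY, eval_map, eval₂_eq_sum_range]
    simp only [coe_evalRingHom, eval_eq_sum_range]
  rw [this]
  fun_prop

theorem fderiv_evalExp (f : ℂ[X][X]) (p : ℂ × ℂ) :
    fderiv ℂ (evalExp f) p (0, 1)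
      = (derivative (f.map (evalRingHom (Complex.exp p.1)))).eval p.2 := by
  have h1 : HasFDerivAt (evalExp f) (fderiv ℂ (evalExp f) p) (p.1, p.2) :=
    ((contDiff_evalExp f).differentiable (by norm_num) p).hasFDerivAt
  have h2 : HasDerivAt (fun y ↦ (p.1, y)) ((0 : ℂ), (1 : ℂ)) p.2 :=
    (hasDerivAt_const _ _).prodMk (hasDerivAt_id _)
  exact (h1.comp_hasDerivAt p.2 h2).unique
    ((f.map (evalRingHom (Complex.exp p.1))).hasDerivAt p.2)

theorem natDegree_map_evalRingHom_of_monomial {f : ℂ[X][X]}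
    (hn : IsNonzeroMonomial f.leadingCoeff) {a : ℂ}
    (ha : a ≠ 0) : (f.map (evalRingHom a)).natDegree = f.natDegree := by
  obtain ⟨c, k, hc, hk⟩ := hn
  refine natDegree_map_of_leadingCoeff_ne_zero _ ?_
  simp [hk, hc, ha]

/-- The roots of `f(exp z, y)` grow at most exponentially in `z`. -/
theorem exists_norm_le_of_evalExp_eq_zero {f : ℂ[X][X]}
    (hn : IsNonzeroMonomial f.leadingCoeff) :
    ∃ K D : ℝ, ∀ p, evalExp f p = 0 → ‖p.2‖ ≤ K * Real.exp (D * ‖p.1‖) := by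
  choose K D hK hD hKD using fun j ↦ exists_norm_eval_exp_le (f.coeff j)
  obtain ⟨c, k, hc, hk⟩ := id hn
  set K' := ∑ j ∈ Finset.range f.natDegree, K j
  set D' := ∑ j ∈ Finset.range f.natDegree, D j
  have hK' : 0 ≤ K' := Finset.sum_nonneg fun j _ ↦ hK j
  have hD' : 0 ≤ D' := Finset.sum_nonneg fun j _ ↦ hD j
  have hc' : 0 < ‖c‖ := norm_pos_iff.2 hc
  refine ⟨K' / ‖c‖ + 1, D' + k, fun p hp ↦ ?_⟩
  set q := f.map (evalRingHom (Complex.exp p.1))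
  have hdeg : q.natDegree = f.natDegree :=
    natDegree_map_evalRingHom_of_monomial hn (Complex.exp_ne_zero _)
  have hlead : q.leadingCoeff = c * Complex.exp p.1 ^ k := by
    rw [leadingCoeff, hdeg, coeff_map, coeff_natDegree, hk]
    simp
  have hlead0 : q.leadingCoeff ≠ 0 := by
    rw [hlead]
    exact mul_ne_zero hc (pow_ne_zero _ (Complex.exp_ne_zero _))
  have hroot := (IsRoot.norm_lt_cauchyBound (leadingCoeff_ne_zero.1 hlead0)
    (show q.IsRoot p.2 from hp)).le
  rw [← NNReal.coe_le_coe, coe_nnnorm] at hroot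
  refine hroot.trans ?_
  have hsup : ((Finset.range q.natDegree).sup fun j ↦ ‖q.coeff j‖₊ : NNReal)
      ≤ K' * Real.exp (D' * ‖p.1‖) := by
    obtain ⟨r, hr⟩ : ∃ r : NNReal, (r : ℝ) = K' * Real.exp (D' * ‖p.1‖) :=
      ⟨⟨_, by positivity⟩, rfl⟩
    rw [← hr, NNReal.coe_le_coe]
    refine Finset.sup_le fun j hj ↦ ?_
    rw [← NNReal.coe_le_coe, coe_nnnorm, hr, coeff_map]
    rw [hdeg] at hj
    refine (hKD j p.1).trans ?_
    gcongr
    · exact Finset.single_le_sum (fun j _ ↦ hK j) hj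
    · exact Finset.single_le_sum (fun j _ ↦ hD j) hj
  have hinv : ‖q.leadingCoeff‖⁻¹ ≤ ‖c‖⁻¹ * Real.exp (k * ‖p.1‖) := by
    rw [hlead, norm_mul, mul_inv, ← norm_inv (Complex.exp p.1 ^ k), ← Complex.exp_nat_mul,
      ← Complex.exp_neg]
    gcongr
    refine (Complex.norm_exp_le_exp_norm _).trans ?_
    rw [norm_neg, norm_mul, Complex.norm_natCast]
  rw [cauchyBound, NNReal.coe_add, NNReal.coe_div, coe_nnnorm, NNReal.coe_one, div_eq_mul_inv,
    add_mul _ _ (Real.exp _), one_mul]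
  refine add_le_add ((mul_le_mul hsup hinv (by positivity) (by positivity)).trans_eq ?_)
    (Real.one_le_exp (by positivity))
  rw [add_mul, Real.exp_add]
  ring

/-- If `f₀` and `f_n` are monomials and all roots of `f(a, y)` are simple for `a ≠ 0`, then the
branches of the curve `f(exp z, y) = 0` are exponentials, all with the same exponent. -/
theorem exists_forall_evalExp_mul_exp_eq_zero {f : ℂ[X][X]}
    (h0 : IsNonzeroMonomial (f.coeff 0)) (hn : IsNonzeroMonomial f.leadingCoeff)
    (hroots : ∀ a : ℂ, a ≠ 0 → ∀ b : ℂ, (f.map (evalRingHom a)).rootMultiplicity b ≤ 1) :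
    ∃ m : ℂ, ∀ b, evalExp f (0, b) = 0 → ∀ z, evalExp f (z, b * Complex.exp (m * z)) = 0 := by
  have hP := contDiff_evalExp f
  have hmap0 : ∀ z, f.map (evalRingHom (Complex.exp z)) ≠ 0 := fun z hz ↦ by
    obtain ⟨c, k, hc, hk⟩ := h0
    have := congrArg (coeff · 0) hz
    simp [hk, hc] at this
  have hP' : ∀ p, evalExp f p = 0 → fderiv ℂ (evalExp f) p (0, 1) ≠ 0 := fun p hp hd ↦ by
    rw [fderiv_evalExp] at hd
    exact (hroots _ (Complex.exp_ne_zero p.1) p.2).not_gt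
      ((one_lt_rootMultiplicity_iff_isRoot (hmap0 p.1)).2 ⟨hp, hd⟩)
  have hne : ∀ z, evalExp f (z, 0) ≠ 0 := fun z hz ↦ by
    obtain ⟨c, k, hc, hk⟩ := h0
    rw [evalExp, evalXY, ← coeff_zero_eq_eval_zero] at hz
    simp [hk, hc] at hz
  obtain ⟨K, D, hKD⟩ := exists_norm_le_of_evalExp_eq_zero hn
  have huniq := fun {a b : ℂ} ↦ existsUnique_curve_section (a := a) (b := b) hP hP'
    (B := fun z ↦ K * Real.exp (D * ‖z‖)) (by fun_prop) hKD
  have hbranch : ∀ b, evalExp f (0, b) = 0 →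
      ∃ m : ℂ, ∀ z, evalExp f (z, b * Complex.exp (m * z)) = 0 := fun b hb ↦ by
    obtain ⟨Y, ⟨hY0, hY⟩, -⟩ := huniq hb
    obtain ⟨m, hm⟩ := exists_eq_mul_exp_of_norm_le
      (differentiable_of_curve_section hP hP' Y.continuous hY)
      (fun z hz ↦ hne z (hz ▸ hY z)) fun z ↦ hKD _ (hY z)
    refine ⟨m, fun z ↦ ?_⟩
    rw [← hY0, ← hm]
    exact hY z
  by_cases hex : ∃ b₀, evalExp f (0, b₀) = 0
  swap
  · exact ⟨0, fun b hb ↦ (hex ⟨b, hb⟩).elim⟩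
  obtain ⟨b₀, hb₀⟩ := hex
  obtain ⟨m₀, hm₀⟩ := hbranch b₀ hb₀
  refine ⟨m₀, fun b hb ↦ ?_⟩
  obtain ⟨m, hm⟩ := hbranch b hb
  by_cases hmm : m = m₀
  · rwa [← hmm]
  have hb0 : b ≠ 0 := by
    rintro rfl
    exact hne 0 hb
  have hb₀0 : b₀ ≠ 0 := by
    rintro rfl
    exact hne 0 hb₀
  -- the two exponentials meet, hence are the same branch
  set z₁ := Complex.log (b₀ / b) / (m - m₀)
  have hmeet : b₀ * Complex.exp (m₀ * z₁) = b * Complex.exp (m * z₁) := by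
    have : m * z₁ = m₀ * z₁ + Complex.log (b₀ / b) := by
      have : (m - m₀) * z₁ = Complex.log (b₀ / b) := mul_div_cancel₀ _ (sub_ne_zero.2 hmm)
      linear_combination this
    rw [this, Complex.exp_add, Complex.exp_log (div_ne_zero hb₀0 hb0)]
    field_simp
  have heq := (huniq (hm z₁)).unique
    (y₁ := ⟨fun z ↦ b * Complex.exp (m * z), by fun_prop⟩)
    (y₂ := ⟨fun z ↦ b₀ * Complex.exp (m₀ * z), by fun_prop⟩) ⟨rfl, hm⟩ ⟨hmeet, hm₀⟩
  have : b = b₀ := by simpa using DFunLike.congr_fun heq 0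
  rwa [this]

/-- If `p(exp z)` is a multiple of `exp (μ z)`, then `p` is a monomial of exponent `μ`. -/
theorem coeff_exponent_eq_of_eval_exp {p : ℂ[X]} {μ K : ℂ}
    (h : ∀ z, p.eval (Complex.exp z) = K * Complex.exp (μ * z)) {i : ℕ} (hi : p.coeff i ≠ 0) :
    (i : ℂ) = μ := by
  have heuler : X * derivative p = C μ * p := by
    refine eq_of_infinite_eval_eq _ _
      ((Set.infinite_of_finite_compl (s := {0}ᶜ) (by simp)).mono fun x hx ↦ ?_)
    have hx' := Complex.exp_log hx
    have h1 := (p.hasDerivAt (Complex.exp (Complex.log x))).comp (Complex.log x)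
      (Complex.hasDerivAt_exp _)
    have h2 := (((hasDerivAt_id (Complex.log x)).const_mul μ).cexp).const_mul K
    have h3 := h1.unique (h2.congr_of_eventuallyEq (.of_forall fun z ↦ h z))
    have h4 := h (Complex.log x)
    simp only [id, hx'] at h3 h4
    simp only [Set.mem_ofPred_eq, eval_mul, eval_X, eval_C]
    linear_combination h3 - μ * h4
  have := congrArg (coeff · i) heuler
  cases i with
  | zero => simpa [hi, eq_comm] using this
  | succ i =>
    simp only [coeff_X_mul, coeff_derivative, coeff_C_mul] at this
    refine mul_left_cancel₀ hi ?_
    push_cast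
    linear_combination this

theorem exists_exponent_eq_of_simple_roots {f : ℂ[X][X]}
    (h0 : IsNonzeroMonomial (f.coeff 0)) (hn : IsNonzeroMonomial f.leadingCoeff)
    (hroots : ∀ a : ℂ, a ≠ 0 → ∀ b : ℂ, (f.map (evalRingHom a)).rootMultiplicity b ≤ 1) :
    ∃ l m : ℂ, ∀ i j : ℕ, (f.coeff j).coeff i ≠ 0 → (i : ℂ) + m * j = l := by
  obtain ⟨m, hm⟩ := exists_forall_evalExp_mul_exp_eq_zero h0 hn hroots
  obtain ⟨c, k, hc, hk⟩ := id hn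
  set q := f.map (evalRingHom 1)
  have hqdeg : q.natDegree = f.natDegree :=
    natDegree_map_evalRingHom_of_monomial hn one_ne_zero
  have hcard : q.roots.toFinset.card = f.natDegree := by
    rw [Multiset.toFinset_card_of_nodup, IsAlgClosed.card_roots_eq_natDegree, hqdeg]
    exact Multiset.nodup_iff_count_le_one.2 fun b ↦ by
      rw [count_roots]
      exact hroots 1 one_ne_zero b
  refine ⟨k + f.natDegree * m, m, fun i j hij ↦ ?_⟩
  have hpoly : ∀ z, (f.map (evalRingHom (Complex.exp z))).comp (C (Complex.exp (m * z)) * X)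
      = C (Complex.exp ((k + f.natDegree * m) * z)) * q := fun z ↦ by
    refine eq_of_degree_sub_lt_of_eval_finset_eq q.roots.toFinset ?_ fun b hb ↦ ?_
    · rw [hcard, degree_lt_iff_coeff_zero]
      intro j hj
      rw [coeff_sub, comp_C_mul_X_coeff, coeff_C_mul, coeff_map, coeff_map]
      rcases hj.eq_or_lt with rfl | hj
      · rw [coeff_natDegree, hk]
        simp only [map_mul, map_pow, coe_evalRingHom, eval_C, eval_X, one_pow, mul_one,
          ← Complex.exp_nat_mul]
        rw [mul_assoc, ← Complex.exp_add, mul_comm c, sub_eq_zero]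
        ring_nf
      · simp [coeff_eq_zero_of_natDegree_lt hj]
    · have hqb : q.eval b = 0 := (mem_roots'.1 (Multiset.mem_toFinset.1 hb)).2
      have := hm b (by simpa [evalExp, evalXY] using hqb) z
      rw [eval_comp, eval_mul, eval_mul, hqb, eval_C, eval_X, mul_zero, mul_comm]
      exact this
  have hexp := coeff_exponent_eq_of_eval_exp (p := f.coeff j)
    (μ := k + f.natDegree * m - m * j) (K := q.coeff j) (fun z ↦ by
      have := congrArg (coeff · j) (hpoly z)
      simp only [comp_C_mul_X_coeff, coeff_C_mul, coeff_map, coe_evalRingHom,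
        ← Complex.exp_nat_mul] at this
      rw [sub_mul, Complex.exp_sub, mul_div_assoc', eq_div_iff (Complex.exp_ne_zero _),
        mul_comm (q.coeff j), ← this]
      ring_nf) hij
  rw [hexp]
  ring

theorem exists_weights_of_exponent_eq {f : ℂ[X][X]} (h0 : f.coeff 0 ≠ 0) {l m : ℂ}
    (h : ∀ i j : ℕ, (f.coeff j).coeff i ≠ 0 → (i : ℂ) + m * j = l) :
    ∃ w α β : ℤ, α ≠ 0 ∧
      ∀ i j : ℕ, (f.coeff j).coeff i ≠ 0 → α * (i : ℤ) + β * (j : ℤ) = w := by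
  have hl := h _ 0 (leadingCoeff_ne_zero.2 h0)
  set r := (f.coeff 0).natDegree
  simp only [Nat.cast_zero, mul_zero, add_zero] at hl
  rcases eq_or_ne f.natDegree 0 with hdeg | hdeg
  · refine ⟨r, 1, 0, one_ne_zero, fun i j hij ↦ ?_⟩
    have hj : j = 0 := by
      by_contra hj
      exact hij (by simp [coeff_eq_zero_of_natDegree_lt (hdeg ▸ Nat.pos_of_ne_zero hj)])
    have := h i j hij
    rw [← hl, hj, Nat.cast_zero, mul_zero, add_zero, Nat.cast_inj] at this
    simp [this]
  · have hf : f ≠ 0 := by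
      rintro rfl
      exact hdeg natDegree_zero
    have hN := h _ _ (leadingCoeff_ne_zero.2 (leadingCoeff_ne_zero.2 hf))
    set n := f.natDegree
    set k := (f.coeff n).natDegree
    refine ⟨n * r, n, r - k, by exact_mod_cast hdeg, fun i j hij ↦ ?_⟩
    have hi := h i j hij
    have : ((n : ℂ) * i + (r - k) * j) = n * r := by
      linear_combination n * hi + (j - n) * hl - j * hN
    exact_mod_cast this

/-- Main theorem, equivalence (A) ⇔ (B): for a reduced (squarefree) bivariate polynomial
`f = Σ_{i=0}^n f_i(x) y^i` with `f₀ ≠ 0` and `f_n ≠ 0`, quasi-homogeneity with nonzero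
weight of `x` is equivalent to `f₀`, `f_n` being nonzero monomials and `f(a, y)` having
no repeated root for all `a ∈ ℂ^×`. -/
theorem quasiHomogeneous_iff_discriminant_monomial
    (f : Polynomial (Polynomial ℂ)) (n : ℕ) (hn : n = f.natDegree)
    (hsf : Squarefree f) (h0 : f.coeff 0 ≠ 0) (hN : f.coeff n ≠ 0) :
    (∃ w α β : ℤ, α ≠ 0 ∧
        ∀ i j : ℕ, (f.coeff j).coeff i ≠ 0 → α * (i : ℤ) + β * (j : ℤ) = w) ↔
      (IsNonzeroMonomial (f.coeff 0) ∧ IsNonzeroMonomial (f.coeff n) ∧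
        ∀ a : ℂ, a ≠ 0 →
          ∀ b : ℂ, (f.map (evalRingHom a)).rootMultiplicity b ≤ 1) := by
  subst hn
  constructor
  · rintro ⟨w, α, β, hα, h⟩
    have hmono : ∀ j, f.coeff j ≠ 0 → IsNonzeroMonomial (f.coeff j) := fun j hj ↦
      isNonzeroMonomial_of_support hj fun i i' hi hi' ↦ by
        have := mul_left_cancel₀ hα (add_right_cancel ((h i j hi).trans (h i' j hi').symm))
        exact_mod_cast this
    exact ⟨hmono 0 h0, hmono _ hN, fun a ha b ↦
      rootMultiplicity_le_one_of_quasiHomogeneous hsf hα h ha b⟩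
  · rintro ⟨hm0, hmN, hroots⟩
    obtain ⟨l, m, h⟩ := exists_exponent_eq_of_simple_roots hm0 hmN hroots
    exact exists_weights_of_exponent_eq h0 h
end

section
/- Let f ∈ ℂ[x,y] be a squarefree (reduced) polynomial, written f = Σ_{i=0}^n f_i(x)·y^i with f_i ∈ ℂ[x], n = deg_y f, and f₀ ≠ 0, f_n ≠ 0. Then the following are equivalent: (A) f is quasi-homogeneous with the weight of x nonzero, i.e. there exist integers w, α, β with α ≠ 0 such that α·i + β·j = w for every monomial x^i y^j appearing in f with nonzero coefficient; (C) for every a ∈ ℂ with a ≠ 0 one has f_n(a) ≠ 0, and there is no b ∈ ℂ with f(a,b) = 0 and b·(∂f/∂y)(a,b) = 0. -/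
open Polynomial

section Discriminant

variable {R : Type*} [CommRing R] [IsDomain R] [NormalizedGCDMonoid R]

open nonZeroDivisors in
/-- The **Gauss lemma** for squarefree polynomials. -/
theorem Squarefree.map_fraction_map (K : Type*) [Field K] [Algebra R K] [IsFractionRing R K]
    {f : R[X]} (hf : Squarefree f) : Squarefree (f.map (algebraMap R K)) := by
  have hf0 : f.map (algebraMap R K) ≠ 0 :=
    (Polynomial.map_ne_zero_iff (IsFractionRing.injective R K)).2 hf.ne_zero
  intro q hq
  have hq0 : q ≠ 0 := by
    rintro rfl
    exact hf0 (by simpa using hq)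
  obtain ⟨b, hb, hbq⟩ := IsLocalization.integerNormalization_spec R⁰ q
  set P := (IsLocalization.integerNormalization R⁰ q).primPart with hP
  have hPq : P.map (algebraMap R K) ∣ q := by
    have hb0 : algebraMap R K b ≠ 0 := IsFractionRing.to_map_ne_zero_of_mem_nonZeroDivisors hb
    have h : P.map (algebraMap R K) ∣ C (algebraMap R K b) * q := by
      rw [← smul_eq_C_mul, algebraMap_smul, ← hbq]
      exact Polynomial.map_dvd _ (primPart_dvd _)
    exact ((isUnit_C.2 hb0.isUnit).dvd_mul_left).1 h
  have hPf : P * P ∣ f :=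
    ((isPrimitive_primPart _).mul (isPrimitive_primPart _)).dvd_of_fraction_map_dvd_fraction_map
      (K := K) (by rw [Polynomial.map_mul]; exact (mul_dvd_mul hPq hPq).trans hq)
  exact isUnit_or_eq_zero_of_isUnit_integerNormalization_primPart hq0 (hf P hPf)

/-- In characteristic zero, the ideal generated by a squarefree nonconstant polynomial and its
derivative contains a nonzero constant. -/
theorem Squarefree.exists_mul_add_derivative_mul_eq_C [CharZero R] {f : R[X]}
    (hf : Squarefree f) (hd : f.natDegree ≠ 0) :
    ∃ r : R, r ≠ 0 ∧ ∃ p q : R[X], f * p + derivative f * q = C r := by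
  let K := FractionRing R
  have hinj := IsFractionRing.injective R K
  have : CharZero K := charZero_of_injective_algebraMap hinj
  refine ⟨f.resultant (derivative f), fun h0 ↦ ?_, ?_⟩
  · have hsep : (f.map (algebraMap R K)).Separable :=
      PerfectField.separable_iff_squarefree.2 (hf.map_fraction_map K)
    rw [Polynomial.Separable, derivative_map] at hsep
    have h := resultant_map_map f (derivative f) f.natDegree (derivative f).natDegree
      (algebraMap R K)
    rw [h0, map_zero, ← natDegree_map_eq_of_injective hinj f,
      ← natDegree_map_eq_of_injective hinj (derivative f)] at h
    exact (resultant_eq_zero_iff.1 h).2 hsep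
  · obtain ⟨p, q, -, -, h⟩ :=
      exists_mul_add_mul_eq_C_resultant f (derivative f) le_rfl le_rfl (Or.inl hd)
    exact ⟨p, q, h⟩

end Discriminant

section QuasiHomogeneous

/-- `f` is quasi-homogeneous of type `(w; α, β)`. -/
def IsQuasiHomogeneous (w α β : ℤ) (f : ℂ[X][X]) : Prop :=
  ∀ i j : ℕ, (f.coeff j).coeff i ≠ 0 → α * (i : ℤ) + β * (j : ℤ) = w

variable {w α β : ℤ} {f : ℂ[X][X]}

theorem IsQuasiHomogeneous.derivative (hf : IsQuasiHomogeneous w α β f) :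
    IsQuasiHomogeneous (w - β) α β (derivative f) := by
  intro i j hij
  rw [coeff_derivative] at hij
  have h : (f.coeff (j + 1)).coeff i ≠ 0 := by
    intro h
    apply hij
    rw [← Nat.cast_succ, ← C_eq_natCast, coeff_mul_C, h, zero_mul]
  have := hf i (j + 1) h
  push_cast at this
  linarith

theorem evalXY_eq_sum (a b : ℂ) (f : ℂ[X][X]) :
    evalXY a b f = f.sum fun j p ↦ p.sum fun i c ↦ c * a ^ i * b ^ j := by
  rw [evalXY, eval_map, eval₂_eq_sum]
  refine Finset.sum_congr rfl fun j _ ↦ ?_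
  simp only [coe_evalRingHom, eval_eq_sum, Polynomial.sum, Finset.sum_mul]

theorem IsQuasiHomogeneous.evalXY_zpow_mul (hf : IsQuasiHomogeneous w α β f) {s : ℂ} (hs : s ≠ 0)
    (a b : ℂ) : evalXY (s ^ α * a) (s ^ β * b) f = s ^ w * evalXY a b f := by
  simp only [evalXY_eq_sum, Polynomial.sum, Finset.mul_sum]
  refine Finset.sum_congr rfl fun j _ ↦ Finset.sum_congr rfl fun i hi ↦ ?_
  rw [← hf i j (mem_support_iff.1 hi), zpow_add₀ hs, zpow_mul, zpow_mul, zpow_natCast,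
    zpow_natCast, mul_pow, mul_pow]
  ring

theorem IsQuasiHomogeneous.eval_coeff_ne_zero (hf : IsQuasiHomogeneous w α β f) (hα : α ≠ 0)
    {j : ℕ} (hj : f.coeff j ≠ 0) {a : ℂ} (ha : a ≠ 0) : (f.coeff j).eval a ≠ 0 := by
  have hmon : f.coeff j = monomial (f.coeff j).natDegree (f.coeff j).leadingCoeff := by
    ext i
    rw [coeff_monomial]
    split_ifs with hi
    · rw [← hi, leadingCoeff]
    · by_contra h
      have h₁ := hf i j h
      rw [← hf _ j (leadingCoeff_ne_zero.2 hj)] at h₁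
      have : (i : ℤ) = (f.coeff j).natDegree := mul_left_cancel₀ hα (add_right_cancel h₁)
      exact hi (by exact_mod_cast this.symm)
  rw [hmon, eval_monomial]
  exact mul_ne_zero (leadingCoeff_ne_zero.2 hj) (pow_ne_zero _ ha)

open Complex in
theorem Complex.exists_zpow_eq {α : ℤ} (hα : α ≠ 0) {x : ℂ} (hx : x ≠ 0) :
    ∃ s : ℂ, s ≠ 0 ∧ s ^ α = x := by
  refine ⟨exp (log x / α), exp_ne_zero _, ?_⟩
  rw [← exp_int_mul, mul_div_cancel₀ _ (Int.cast_ne_zero.2 hα), exp_log hx]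

theorem evalXY_eq_evalEval (a b : ℂ) (f : ℂ[X][X]) : evalXY a b f = f.evalEval a b :=
  map_evalRingHom_eval a b f

theorem IsQuasiHomogeneous.not_exists_common_zero (hf : IsQuasiHomogeneous w α β f) (hα : α ≠ 0)
    (hsf : Squarefree f) (h0 : f.coeff 0 ≠ 0) {a : ℂ} (ha : a ≠ 0) :
    ¬ ∃ b : ℂ, evalXY a b f = 0 ∧ b * evalXY a b (Polynomial.derivative f) = 0 := by
  rintro ⟨b, hb, hb'⟩
  rcases eq_or_ne f.natDegree 0 with hd | hd
  · apply hf.eval_coeff_ne_zero hα h0 ha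
    rw [evalXY, eq_C_of_natDegree_eq_zero hd] at hb
    simpa using hb
  rcases mul_eq_zero.1 hb' with rfl | hb'
  · apply hf.eval_coeff_ne_zero hα h0 ha
    rw [evalXY, ← coeff_zero_eq_eval_zero, coeff_map] at hb
    exact hb
  obtain ⟨r, hr, p, q, hpq⟩ := hsf.exists_mul_add_derivative_mul_eq_C hd
  have hroot : ∀ x ≠ 0, r.eval x = 0 := by
    intro x hx
    obtain ⟨s, hs, hsx⟩ := Complex.exists_zpow_eq hα (div_ne_zero hx ha)
    have h := congr(evalEval (s ^ α * a) (s ^ β * b) $hpq)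
    rwa [evalEval_add, evalEval_mul, evalEval_mul, evalEval_C, ← evalXY_eq_evalEval,
      ← evalXY_eq_evalEval _ _ (Polynomial.derivative f), hf.evalXY_zpow_mul hs,
      hf.derivative.evalXY_zpow_mul hs, hb, hb', mul_zero, mul_zero, zero_mul, zero_mul, zero_add,
      hsx, div_mul_cancel₀ _ ha, eq_comm] at h
  refine hr (eq_zero_of_infinite_isRoot r ((Set.finite_singleton (0 : ℂ)).infinite_compl.mono ?_))
  exact fun x hx ↦ hroot x hx

end QuasiHomogeneous

section EntireFunctions

open Complex Metric

/-- An entire function whose real part grows at most linearly is affine. -/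
theorem Complex.exists_eq_add_mul_of_re_le {g : ℂ → ℂ} (hg : Differentiable ℂ g) {A K : ℝ}
    (h : ∀ z, (g z).re ≤ A + K * ‖z‖) : ∃ p : ℂ, ∀ z, g z = g 0 + p * z := by
  wlog hAK : 0 < A ∧ 0 ≤ K generalizing A K
  · refine this (A := |A| + 1) (K := |K|) (fun z ↦ (h z).trans ?_) ⟨by positivity, abs_nonneg _⟩
    gcongr
    · linarith [le_abs_self A]
    · exact le_abs_self K
  obtain ⟨hA, hK⟩ := hAK
  have hbound : ∀ z, ‖g z‖ ≤ (2 * (A + K) + 3 * ‖g 0‖) + 4 * K * ‖z‖ := by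
    intro z
    have hz := norm_nonneg z
    have hR : 0 < 2 * ‖z‖ + 1 := by positivity
    have hM : 0 < A + K * (2 * ‖z‖ + 1) := by positivity
    have hb := borelCaratheodory (R := 2 * ‖z‖ + 1) (M := A + K * (2 * ‖z‖ + 1)) (z := z) hM
      hg.differentiableOn (fun w hw ↦ (h w).trans ?_) hR (mem_ball_zero_iff.2 (by linarith))
    · have hden : 2 * ‖z‖ + 1 - ‖z‖ = ‖z‖ + 1 := by ring
      rw [hden] at hb
      refine hb.trans ?_
      rw [← add_div, div_le_iff₀ (by positivity)]
      have := norm_nonneg (g 0)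
      nlinarith [mul_nonneg hz this, mul_nonneg hK hz, mul_nonneg hA.le hz,
        mul_nonneg (mul_nonneg hK hz) hz]
    · have := mem_ball_zero_iff.1 hw
      gcongr
  set B := 2 * (A + K) + 3 * ‖g 0‖ with hB
  have hB0 : 0 ≤ B := by positivity
  have hderiv : ∀ z, ‖deriv g z‖ ≤ B + 8 * K := by
    intro z
    have hR : 0 < ‖z‖ + 1 := by positivity
    refine (norm_deriv_le_of_forall_mem_sphere_norm_le hR hg.diffContOnCl
      (C := (B + 8 * K) * (‖z‖ + 1)) fun w hw ↦ (hbound w).trans ?_).trans_eq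
      (mul_div_cancel_right₀ _ hR.ne')
    have hw' : ‖w‖ ≤ 2 * ‖z‖ + 1 := by
      have := norm_add_le (w - z) z
      rw [sub_add_cancel, mem_sphere_iff_norm.1 hw] at this
      linarith
    nlinarith [mul_le_mul_of_nonneg_left hw' hK, mul_nonneg hB0 (norm_nonneg z),
      mul_nonneg hK (norm_nonneg z)]
  have hconst : ∀ z, deriv g z = deriv g 0 := fun z ↦
    (hg.deriv).apply_eq_apply_of_bounded
      (isBounded_iff_forall_norm_le.2 ⟨B + 8 * K, by rintro _ ⟨w, rfl⟩; exact hderiv w⟩) z 0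
  refine ⟨deriv g 0, fun z ↦ ?_⟩
  have hd : Differentiable ℂ fun z ↦ g z - deriv g 0 * z := by fun_prop
  have := is_const_of_deriv_eq_zero hd (fun w ↦ by
    have hw := (hg w).hasDerivAt.sub ((hasDerivAt_id w).const_mul (deriv g 0))
    rw [mul_one, hconst w, sub_self] at hw
    exact hw.deriv) z 0
  simp only [mul_zero, sub_zero] at this
  rw [← this]
  ring

/-- A nowhere vanishing entire function is the exponential of an entire function. -/
theorem Complex.exists_eq_exp_of_ne_zero {h : ℂ → ℂ} (hh : Differentiable ℂ h) (h0 : ∀ z, h z ≠ 0) :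
    ∃ g : ℂ → ℂ, Differentiable ℂ g ∧ ∀ z, h z = exp (g z) := by
  have hlog : Differentiable ℂ fun z ↦ deriv h z / h z := hh.deriv.div hh h0
  obtain ⟨g, hg0, hg⟩ := hlog.isExactOn_univ.with_val_at 0 (log (h 0))
  have hgd : ∀ z, HasDerivAt g (deriv h z / h z) z := fun z ↦ hg z (Set.mem_univ z)
  refine ⟨g, fun z ↦ (hgd z).differentiableAt, fun z ↦ ?_⟩
  have hd : ∀ z, HasDerivAt (fun z ↦ h z * exp (-g z)) 0 z := fun z ↦
    ((hh z).hasDerivAt.mul (hgd z).neg.cexp).congr_deriv (by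
      simp only [Pi.neg_apply]
      field_simp [h0 z]
      ring)
  have := is_const_of_deriv_eq_zero (fun z ↦ (hd z).differentiableAt) (fun z ↦ (hd z).deriv) z 0
  simp only [hg0, exp_neg, exp_log (h0 0), mul_inv_cancel₀ (h0 0)] at this
  exact (mul_inv_eq_one₀ (exp_ne_zero _)).1 this

/-- A nowhere vanishing entire function of order one and finite type is, up to a constant factor,
an exponential. -/
theorem Complex.exists_eq_mul_exp_of_norm_le {h : ℂ → ℂ} (hh : Differentiable ℂ h)
    (h0 : ∀ z, h z ≠ 0) {A K : ℝ} (hAK : ∀ z, ‖h z‖ ≤ Real.exp (A + K * ‖z‖)) :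
    ∃ p : ℂ, ∀ z, h z = h 0 * exp (p * z) := by
  obtain ⟨g, hg, hgh⟩ := exists_eq_exp_of_ne_zero hh h0
  obtain ⟨p, hp⟩ := exists_eq_add_mul_of_re_le hg (A := A) (K := K) fun z ↦ by
    rw [← Real.exp_le_exp, ← norm_exp, ← hgh]
    exact hAK z
  exact ⟨p, fun z ↦ by rw [hgh, hgh, hp z, exp_add]⟩

theorem Complex.exponent_eq_of_forall_mul_exp_ne {c d p q : ℂ} (hc : c ≠ 0) (hd : d ≠ 0)
    (h : ∀ z, c * exp (p * z) ≠ d * exp (q * z)) : p = q := by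
  by_contra hpq
  have hpq' : p - q ≠ 0 := sub_ne_zero.2 hpq
  apply h (log (d / c) / (p - q))
  have : p * (log (d / c) / (p - q)) = q * (log (d / c) / (p - q)) + log (d / c) := by
    field_simp
    ring
  rw [this, exp_add, exp_log (div_ne_zero hd hc)]
  field_simp

theorem Complex.exponent_eq_of_forall_exp_eq {p q : ℂ} (h : ∀ z, exp (p * z) = exp (q * z)) :
    p = q := by
  have hd : ∀ r : ℂ, deriv (fun z ↦ exp (r * z)) 0 = r := fun r ↦ by
    simpa using (((hasDerivAt_id (0 : ℂ)).const_mul r).cexp).deriv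
  rw [← hd p, ← hd q, funext h]

end EntireFunctions

section ImplicitCovering

open Filter Topology

section

variable {𝕜 : Type*} [RCLike 𝕜]
  {E₁ : Type*} [NormedAddCommGroup E₁] [NormedSpace 𝕜 E₁] [CompleteSpace E₁]
  {E₂ : Type*} [NormedAddCommGroup E₂] [NormedSpace 𝕜 E₂] [CompleteSpace E₂]
  {F : Type*} [NormedAddCommGroup F] [NormedSpace 𝕜 F] [CompleteSpace F]
  {G : E₁ × E₂ → F} {G' : E₁ × E₂ → E₁ × E₂ →L[𝕜] F}

theorem isLocalHomeomorph_fst_zeroLocus (hG : ∀ v, G v = 0 → HasStrictFDerivAt G (G' v) v)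
    (hinv : ∀ v, G v = 0 → (G' v ∘L .inr 𝕜 E₁ E₂).IsInvertible) :
    IsLocalHomeomorph fun v : {v // G v = 0} ↦ v.1.1 := by
  have hopen : IsOpenMap fun v : {v // G v = 0} ↦ v.1.1 := by
    refine .of_nhds_le fun u s hs ↦ ?_
    obtain ⟨t, ht, hts⟩ := (mem_nhds_subtype _ _ _).1 hs
    have hψ := (hG u u.2).tendsto_implicitFunctionOfProdDomain (hinv u u.2)
    have hψ₀ := (hG u u.2).eventually_apply_implicitFunctionOfProdDomain (hinv u u.2)
    filter_upwards [hψ₀, (tendsto_id.prodMk_nhds hψ) ht] with z hz hzt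
    exact @hts ⟨_, hz.trans u.2⟩ hzt
  refine isLocalHomeomorph_iff_isOpenEmbedding_restrict.2 fun u ↦ ?_
  have hψ := (hG u u.2).eventually_apply_eq_iff_implicitFunctionOfProdDomain (hinv u u.2)
  obtain ⟨U, hU, hUo, huU⟩ := mem_nhds_iff.1 (continuous_subtype_val.continuousAt hψ)
  refine ⟨U, hUo.mem_nhds huU, .of_continuous_injective_isOpenMap (by fun_prop) ?_
    (hopen.domRestrict hUo)⟩
  intro v w hvw
  have hvw' : v.1.1.1 = w.1.1.1 := hvw
  have hv := (hU v.2).1 (v.1.2.trans u.2.symm)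
  have hw := (hU w.2).1 (w.1.2.trans u.2.symm)
  refine Subtype.ext (Subtype.ext (Prod.ext hvw' ?_))
  rw [← hv, ← hw, hvw']

theorem differentiable_of_forall_apply_eq_zero (hG : ∀ v, G v = 0 → HasStrictFDerivAt G (G' v) v)
    (hinv : ∀ v, G v = 0 → (G' v ∘L .inr 𝕜 E₁ E₂).IsInvertible) {h : E₁ → E₂} (hh : Continuous h)
    (hGh : ∀ z, G (z, h z) = 0) : Differentiable 𝕜 h := by
  intro z
  have hu := hGh z
  have hψ := (hG _ hu).eventually_apply_eq_iff_implicitFunctionOfProdDomain (hinv _ hu)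
  have ht : Tendsto (fun w ↦ (w, h w)) (𝓝 z) (𝓝 (z, h z)) :=
    tendsto_id.prodMk_nhds hh.continuousAt
  refine ((hG _ hu).hasStrictFDerivAt_implicitFunctionOfProdDomain
    (hinv _ hu)).hasFDerivAt.differentiableAt.congr_of_eventuallyEq ?_
  filter_upwards [ht.eventually hψ] with w hw
  exact (hw.1 ((hGh w).trans hu.symm)).symm

variable [ProperSpace E₁] [ProperSpace E₂]

theorem isCoveringMap_fst_zeroLocus (hG : ∀ v, G v = 0 → HasStrictFDerivAt G (G' v) v)
    (hinv : ∀ v, G v = 0 → (G' v ∘L .inr 𝕜 E₁ E₂).IsInvertible) (hGc : Continuous G)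
    {B : E₁ → ℝ} (hB : Continuous B) (hGB : ∀ v, G v = 0 → ‖v.2‖ ≤ B v.1) :
    IsCoveringMap fun v : {v // G v = 0} ↦ v.1.1 := by
  have hloc := isLocalHomeomorph_fst_zeroLocus hG hinv
  have hcpt : ∀ ⦃K : Set E₁⦄, IsCompact K →
      IsCompact ((fun v : {v // G v = 0} ↦ v.1.1) ⁻¹' K) := by
    intro K hK
    obtain ⟨M, hM⟩ := hK.bddAbove_image hB.continuousOn
    have hcl : IsClosed {v | G v = 0} := isClosed_singleton.preimage hGc
    refine (hcl.isClosedEmbedding_subtypeVal.isCompact_preimage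
      (hK.prod (isCompact_closedBall (0 : E₂) M))).of_isClosed_subset
      (hK.isClosed.preimage (by fun_prop)) fun v hv ↦ ⟨hv, ?_⟩
    exact mem_closedBall_zero_iff.2 ((hGB v v.2).trans (hM ⟨_, hv, rfl⟩))
  have hclosed := (isProperMap_iff_isCompact_preimage.2 ⟨hloc.continuous, hcpt⟩).isClosedMap
  rw [isCoveringMap_iff_isCoveringMapOn_univ]
  refine hclosed.isCoveringMapOn_of_isLocalHomeomorphOn (fun z _ ↦ ?_) hloc.isLocalHomeomorphOn
  refine (hcpt isCompact_singleton).finite (.of_openPartialHomeomorph _ subset_rfl fun e _ ↦ ?_)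
  obtain ⟨φ, hφ, h⟩ := hloc e
  exact ⟨φ, hφ, h.symm⟩

section

variable [SimplyConnectedSpace E₁] [LocallyPathConnectedSpace E₁]

/-- A polynomial-like equation with simple, locally bounded roots can be solved globally over a
simply connected base. -/
theorem exists_differentiable_of_apply_eq_zero
    (hG : ∀ v, G v = 0 → HasStrictFDerivAt G (G' v) v)
    (hinv : ∀ v, G v = 0 → (G' v ∘L .inr 𝕜 E₁ E₂).IsInvertible) (hGc : Continuous G)
    {B : E₁ → ℝ} (hB : Continuous B) (hGB : ∀ v, G v = 0 → ‖v.2‖ ≤ B v.1)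
    {x₀ : E₁} {y₀ : E₂} (h₀ : G (x₀, y₀) = 0) :
    ∃ h : E₁ → E₂, Differentiable 𝕜 h ∧ h x₀ = y₀ ∧ ∀ x, G (x, h x) = 0 := by
  obtain ⟨H, ⟨hH₀, hH⟩, -⟩ := (isCoveringMap_fst_zeroLocus hG hinv hGc hB
    hGB).existsUnique_continuousMap_lifts (.id E₁) x₀ ⟨(x₀, y₀), h₀⟩ rfl
  have hHx : ∀ x, ((H x).1.1, (H x).1.2) = (x, (H x).1.2) := fun x ↦
    congr(($(congrFun hH x), (H x).1.2))
  have hzero : ∀ x, G (x, (H x).1.2) = 0 := fun x ↦ by rw [← hHx]; exact (H x).2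
  exact ⟨fun x ↦ (H x).1.2, differentiable_of_forall_apply_eq_zero hG hinv (by fun_prop) hzero,
    by simp [hH₀], hzero⟩

end

theorem eq_of_forall_apply_eq_zero_of_apply_eq [PreconnectedSpace E₁]
    (hG : ∀ v, G v = 0 → HasStrictFDerivAt G (G' v) v)
    (hinv : ∀ v, G v = 0 → (G' v ∘L .inr 𝕜 E₁ E₂).IsInvertible) (hGc : Continuous G)
    {B : E₁ → ℝ} (hB : Continuous B) (hGB : ∀ v, G v = 0 → ‖v.2‖ ≤ B v.1)
    {h₁ h₂ : E₁ → E₂} (hc₁ : Continuous h₁) (hc₂ : Continuous h₂) (hz₁ : ∀ x, G (x, h₁ x) = 0)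
    (hz₂ : ∀ x, G (x, h₂ x) = 0) {x : E₁} (hx : h₁ x = h₂ x) : h₁ = h₂ := by
  have := (isCoveringMap_fst_zeroLocus hG hinv hGc hB hGB).eq_of_comp_eq
    (g₁ := fun x ↦ ⟨(x, h₁ x), hz₁ x⟩) (g₂ := fun x ↦ ⟨(x, h₂ x), hz₂ x⟩)
    (by fun_prop) (by fun_prop) rfl x (by simp [hx])
  exact funext fun x ↦ congr(($(congrFun this x)).1.2)

end

end ImplicitCovering

section Roots

open Complex

theorem Polynomial.exists_eq_C_mul_X_pow_of_eval_ne_zero {p : ℂ[X]}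
    (hp : ∀ a, a ≠ 0 → p.eval a ≠ 0) : ∃ c m, c ≠ 0 ∧ p = C c * X ^ m := by
  have hp0 : p ≠ 0 := by
    rintro rfl
    exact hp 1 one_ne_zero eval_zero
  refine ⟨p.leadingCoeff, p.natDegree, leadingCoeff_ne_zero.2 hp0, ?_⟩
  have hroots : p.roots = Multiset.replicate p.natDegree 0 :=
    Multiset.eq_replicate.2 ⟨IsAlgClosed.card_roots_eq_natDegree, fun a ha ↦ by
      by_contra h
      exact hp a h (isRoot_of_mem_roots ha)⟩
  conv_lhs => rw [← C_leadingCoeff_mul_prod_multiset_X_sub_C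
    (p := p) IsAlgClosed.card_roots_eq_natDegree, hroots]
  simp

theorem Polynomial.norm_eval_exp_le (q : ℂ[X]) {D : ℕ} (hD : q.natDegree ≤ D) (z : ℂ) :
    ‖q.eval (exp z)‖ ≤ (q.sum fun _ c ↦ ‖c‖) * Real.exp (D * ‖z‖) := by
  rw [eval_eq_sum, Polynomial.sum, Polynomial.sum, Finset.sum_mul]
  refine norm_sum_le_of_le _ fun i hi ↦ ?_
  rw [← exp_nat_mul, norm_mul, norm_exp]
  gcongr
  calc (i * z : ℂ).re ≤ ‖(i * z : ℂ)‖ := re_le_norm _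
    _ = i * ‖z‖ := by simp
    _ ≤ D * ‖z‖ := by gcongr; exact (le_natDegree_of_mem_supp i hi).trans hD

theorem evalXY_derivative_eq (a b : ℂ) (f : ℂ[X][X]) :
    evalXY a b (derivative f) = (derivative (f.map (evalRingHom a))).eval b := by
  rw [evalXY, derivative_map]

variable {f : ℂ[X][X]} {c : ℂ} {m : ℕ}

theorem natDegree_map_evalRingHom {a : ℂ} (h : (f.coeff f.natDegree).eval a ≠ 0) :
    (f.map (evalRingHom a)).natDegree = f.natDegree :=
  natDegree_map_of_leadingCoeff_ne_zero _ h

theorem exists_norm_le_exp_of_evalXY_eq_zero (hc : c ≠ 0)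
    (hf : f.coeff f.natDegree = C c * X ^ m) :
    ∃ A K : ℝ, ∀ z b : ℂ, evalXY (exp z) b f = 0 → ‖b‖ ≤ Real.exp (A + K * ‖z‖) := by
  set D := (Finset.range f.natDegree).sup fun j ↦ (f.coeff j).natDegree
  set S : ℝ := ∑ j ∈ Finset.range f.natDegree, (f.coeff j).sum fun _ c ↦ ‖c‖
  have hS : 0 ≤ S := Finset.sum_nonneg fun j _ ↦ Finset.sum_nonneg fun i _ ↦ norm_nonneg _
  have hc' : 0 < ‖c‖ := norm_pos_iff.2 hc
  refine ⟨Real.log (S / ‖c‖ + 1), D + m, fun z b hb ↦ ?_⟩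
  set p := f.map (evalRingHom (exp z)) with hp
  have hlc : (f.coeff f.natDegree).eval (exp z) = c * exp (m * z) := by simp [hf, exp_nat_mul]
  have hlc0 : (f.coeff f.natDegree).eval (exp z) ≠ 0 := by
    rw [hlc]
    exact mul_ne_zero hc (exp_ne_zero _)
  have hdeg : p.natDegree = f.natDegree := natDegree_map_evalRingHom hlc0
  have hplc : p.leadingCoeff = c * exp (m * z) := by
    rw [leadingCoeff, hdeg, hp, coeff_map, coe_evalRingHom, hlc]
  have hp0 : p ≠ 0 := leadingCoeff_ne_zero.1 (hplc ▸ hlc ▸ hlc0)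
  have hsup : ((Finset.range p.natDegree).sup (‖p.coeff ·‖₊) : NNReal) ≤
      S * Real.exp (D * ‖z‖) := by
    rw [Finset.sum_mul]
    refine (NNReal.coe_le_coe.2 (Finset.sup_le fun j hj ↦ Finset.single_le_sum
      (f := fun j ↦ ‖p.coeff j‖₊) (fun _ _ ↦ zero_le) hj)).trans ?_
    rw [hdeg, NNReal.coe_sum]
    refine Finset.sum_le_sum fun j hj ↦ ?_
    rw [hp, coeff_map]
    exact (f.coeff j).norm_eval_exp_le
      (Finset.le_sup (f := fun j ↦ (f.coeff j).natDegree) hj) z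
  have hb' : ‖b‖ ≤ S * Real.exp (D * ‖z‖) / (‖c‖ * Real.exp (-(m * ‖z‖))) + 1 := by
    have h₁ := NNReal.coe_le_coe.2 (IsRoot.norm_lt_cauchyBound hp0 hb).le
    rw [cauchyBound, NNReal.coe_add, NNReal.coe_div, NNReal.coe_one, coe_nnnorm, coe_nnnorm] at h₁
    refine h₁.trans ?_
    rw [hplc, norm_mul, norm_exp]
    gcongr
    refine (abs_le.1 ((abs_re_le_norm _).trans_eq ?_)).1
    simp
  refine hb'.trans ?_
  have h1 : 1 ≤ Real.exp ((D + m) * ‖z‖) := Real.one_le_exp (by positivity)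
  rw [Real.exp_add, Real.exp_log (by positivity), Real.exp_neg, add_mul _ _ (‖z‖), Real.exp_add]
  rw [add_mul _ _ (‖z‖), Real.exp_add] at h1
  have : S * Real.exp (D * ‖z‖) / (‖c‖ * (Real.exp (m * ‖z‖))⁻¹) =
      S / ‖c‖ * (Real.exp (D * ‖z‖) * Real.exp (m * ‖z‖)) := by
    field_simp
  rw [this]
  linarith

theorem contDiff_evalXY (f : ℂ[X][X]) : ContDiff ℂ 1 fun v : ℂ × ℂ ↦ evalXY (exp v.1) v.2 f := by
  simp only [evalXY_eq_sum, Polynomial.sum]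
  fun_prop

theorem fderiv_evalXY_comp_inr (f : ℂ[X][X]) (v : ℂ × ℂ) :
    fderiv ℂ (fun v : ℂ × ℂ ↦ evalXY (exp v.1) v.2 f) v ∘L .inr ℂ ℂ ℂ =
      .toSpanSingleton ℂ (evalXY (exp v.1) v.2 (derivative f)) := by
  have h₁ : HasFDerivAt (fun v : ℂ × ℂ ↦ evalXY (exp v.1) v.2 f) _ (v.1, v.2) :=
    ((contDiff_evalXY f).differentiable one_ne_zero v).hasFDerivAt
  have h₂ := h₁.comp v.2 (hasFDerivAt_prodMk_right (𝕜 := ℂ) v.1 v.2)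
  refine h₂.unique ?_
  rw [evalXY_derivative_eq]
  exact ((f.map (evalRingHom (exp v.1))).hasDerivAt v.2).hasFDerivAt

theorem isInvertible_toSpanSingleton {d : ℂ} (hd : d ≠ 0) :
    (ContinuousLinearMap.toSpanSingleton ℂ d).IsInvertible :=
  ⟨ContinuousLinearEquiv.unitsEquivAut ℂ (Units.mk0 d hd), by ext; simp⟩

end Roots

section NoCommonZero

open Complex

variable {f : ℂ[X][X]}

theorem nodup_roots_map_evalRingHom
    (h : ∀ a : ℂ, a ≠ 0 → (f.coeff f.natDegree).eval a ≠ 0 ∧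
      ¬ ∃ b : ℂ, evalXY a b f = 0 ∧ b * evalXY a b (derivative f) = 0)
    {a : ℂ} (ha : a ≠ 0) : (f.map (evalRingHom a)).roots.Nodup := by
  have hlc := (h a ha).1
  have hp0 : f.map (evalRingHom a) ≠ 0 := fun h0 ↦ hlc (by
    simpa using congr(($h0).coeff f.natDegree))
  refine Multiset.nodup_iff_count_le_one.2 fun b ↦ ?_
  rw [count_roots]
  by_contra! hb
  obtain ⟨h₁, h₂⟩ := (one_lt_rootMultiplicity_iff_isRoot hp0).1 hb
  exact (h a ha).2 ⟨b, h₁, by rw [evalXY_derivative_eq, h₂, mul_zero]⟩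

theorem exists_forall_evalXY_exp_eq_zero
    (h : ∀ a : ℂ, a ≠ 0 → (f.coeff f.natDegree).eval a ≠ 0 ∧
      ¬ ∃ b : ℂ, evalXY a b f = 0 ∧ b * evalXY a b (derivative f) = 0) :
    ∃ p : ℂ, ∀ z b : ℂ, evalXY 1 b f = 0 → evalXY (exp z) (exp (p * z) * b) f = 0 := by
  obtain ⟨c, m, hc, hlc⟩ := exists_eq_C_mul_X_pow_of_eval_ne_zero fun a ha ↦ (h a ha).1
  obtain ⟨A, K, hAK⟩ := exists_norm_le_exp_of_evalXY_eq_zero hc hlc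
  set G : ℂ × ℂ → ℂ := fun v ↦ evalXY (exp v.1) v.2 f with hGdef
  have hne : ∀ z b, evalXY (exp z) b f = 0 → b ≠ 0 := by
    rintro z _ hb rfl
    exact (h _ (exp_ne_zero z)).2 ⟨0, hb, zero_mul _⟩
  have hG : ∀ v, G v = 0 → HasStrictFDerivAt G (fderiv ℂ G v) v := fun v _ ↦
    (contDiff_evalXY f).contDiffAt.hasStrictFDerivAt one_ne_zero
  have hinv : ∀ v, G v = 0 → (fderiv ℂ G v ∘L .inr ℂ ℂ ℂ).IsInvertible := fun v hv ↦ by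
    rw [hGdef, fderiv_evalXY_comp_inr]
    exact isInvertible_toSpanSingleton fun hd ↦
      (h _ (exp_ne_zero v.1)).2 ⟨v.2, hv, by rw [hd, mul_zero]⟩
  have hGc : Continuous G := (contDiff_evalXY f).continuous
  have hB : Continuous fun z : ℂ ↦ Real.exp (A + K * ‖z‖) := by fun_prop
  have hGB : ∀ v, G v = 0 → ‖v.2‖ ≤ Real.exp (A + K * ‖v.1‖) := fun v hv ↦ hAK _ _ hv
  have hroot : ∀ b, evalXY 1 b f = 0 →
      ∃ p : ℂ, ∀ z, evalXY (exp z) (exp (p * z) * b) f = 0 := by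
    intro b hb
    obtain ⟨y, hy, hy0, hyG⟩ := exists_differentiable_of_apply_eq_zero hG hinv hGc hB hGB
      (x₀ := 0) (y₀ := b) (by simpa [hGdef] using hb)
    obtain ⟨p, hp⟩ := Complex.exists_eq_mul_exp_of_norm_le hy (fun z ↦ hne z _ (hyG z))
      (fun z ↦ hAK z _ (hyG z))
    refine ⟨p, fun z ↦ ?_⟩
    rw [mul_comm, ← hy0, ← hp]
    exact hyG z
  by_cases hex : ∃ b, evalXY 1 b f = 0
  · obtain ⟨b₀, hb₀⟩ := hex
    obtain ⟨p, hp⟩ := hroot b₀ hb₀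
    refine ⟨p, fun z b hb ↦ ?_⟩
    obtain ⟨q, hq⟩ := hroot b hb
    rcases eq_or_ne b b₀ with rfl | hbb
    · exact hp z
    have hb0 : b ≠ 0 := hne 0 b (by simpa using hb)
    have hb₀0 : b₀ ≠ 0 := hne 0 b₀ (by simpa using hb₀)
    have hpq : p = q := exponent_eq_of_forall_mul_exp_ne hb₀0 hb0 fun w hw ↦ hbb <| by
      have := congrFun (eq_of_forall_apply_eq_zero_of_apply_eq hG hinv hGc hB hGB
        (h₁ := fun z ↦ exp (p * z) * b₀) (h₂ := fun z ↦ exp (q * z) * b) (by fun_prop)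
        (by fun_prop) hp hq (x := w) (by rw [mul_comm, hw, mul_comm])) 0
      simpa using this.symm
    exact hpq ▸ hq z
  · exact ⟨0, fun z b hb ↦ (hex ⟨b, hb⟩).elim⟩

theorem exists_eval_coeff_exp_mul_eq
    (h : ∀ a : ℂ, a ≠ 0 → (f.coeff f.natDegree).eval a ≠ 0 ∧
      ¬ ∃ b : ℂ, evalXY a b f = 0 ∧ b * evalXY a b (derivative f) = 0) :
    ∃ p : ℂ, ∀ (z : ℂ) (j : ℕ),
      (f.coeff f.natDegree).eval 1 * (f.coeff j).eval (exp z) =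
        (f.coeff f.natDegree).eval (exp z) *
          ((f.coeff j).eval 1 * exp (p * z) ^ (f.natDegree - j)) := by
  obtain ⟨p, hp⟩ := exists_forall_evalXY_exp_eq_zero h
  refine ⟨p, fun z j ↦ ?_⟩
  have hdeg₁ := natDegree_map_evalRingHom (h 1 one_ne_zero).1
  have hdeg := natDegree_map_evalRingHom (h _ (exp_ne_zero z)).1
  set q := f.map (evalRingHom 1) with hq
  set r := f.map (evalRingHom (exp z)) with hr
  have hl₁ : q.coeff f.natDegree ≠ 0 := by simpa [hq] using (h 1 one_ne_zero).1
  have hl : r.coeff f.natDegree ≠ 0 := by simpa [hr] using (h _ (exp_ne_zero z)).1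
  have hcard : q.roots.toFinset.card = f.natDegree := by
    rw [Multiset.toFinset_card_of_nodup (nodup_roots_map_evalRingHom h one_ne_zero),
      IsAlgClosed.card_roots_eq_natDegree, hdeg₁]
  have key : C (q.coeff f.natDegree) * r =
      C (r.coeff f.natDegree) * q.scaleRoots (exp (p * z)) := by
    have hL : (C (q.coeff f.natDegree) * r).natDegree = f.natDegree := by
      rw [natDegree_C_mul hl₁, hdeg]
    have hR : (C (r.coeff f.natDegree) * q.scaleRoots (exp (p * z))).natDegree = f.natDegree := by
      rw [natDegree_C_mul hl, natDegree_scaleRoots, hdeg₁]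
    have hL0 : C (q.coeff f.natDegree) * r ≠ 0 :=
      mul_ne_zero (C_ne_zero.2 hl₁) fun h0 ↦ hl (by rw [h0, coeff_zero])
    have hR0 : C (r.coeff f.natDegree) * q.scaleRoots (exp (p * z)) ≠ 0 :=
      mul_ne_zero (C_ne_zero.2 hl) (scaleRoots_ne_zero (fun h0 ↦ hl₁ (by rw [h0, coeff_zero])) _)
    refine eq_of_degree_le_of_eval_index_eq (v := fun b ↦ exp (p * z) * b) q.roots.toFinset
      (mul_right_injective₀ (exp_ne_zero (p * z))).injOn ?_ ?_ ?_ fun b hb ↦ ?_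
    · rw [hcard, degree_eq_natDegree hL0, hL]
    · rw [degree_eq_natDegree hL0, degree_eq_natDegree hR0, hL, hR]
    · rw [leadingCoeff, leadingCoeff, hL, hR, coeff_C_mul, coeff_C_mul, coeff_scaleRoots, hdeg₁,
        Nat.sub_self, pow_zero, mul_one, mul_comm]
    · have hqb : q.eval b = 0 := isRoot_of_mem_roots (Multiset.mem_toFinset.1 hb)
      have hrb : r.eval (exp (p * z) * b) = 0 := hp z b hqb
      rw [eval_mul, eval_mul, scaleRoots_eval_mul, hqb, hrb, mul_zero, mul_zero, mul_zero]
  have := congr(($key).coeff j)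
  rw [coeff_C_mul, coeff_C_mul, coeff_scaleRoots, hdeg₁] at this
  simpa [hq, hr] using this

theorem exists_isQuasiHomogeneous_of_not_exists_common_zero
    (h : ∀ a : ℂ, a ≠ 0 → (f.coeff f.natDegree).eval a ≠ 0 ∧
      ¬ ∃ b : ℂ, evalXY a b f = 0 ∧ b * evalXY a b (derivative f) = 0) :
    ∃ w α β : ℤ, α ≠ 0 ∧ IsQuasiHomogeneous w α β f := by
  obtain ⟨c, m, hc, hm⟩ := exists_eq_C_mul_X_pow_of_eval_ne_zero fun a ha ↦ (h a ha).1
  obtain ⟨p, hp⟩ := exists_eval_coeff_exp_mul_eq h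
  have hmono : ∀ {j : ℕ}, j ≤ f.natDegree → (f.coeff j).eval 1 ≠ 0 →
      ∃ (d : ℂ) (i : ℕ), f.coeff j = C d * X ^ i ∧ (i : ℂ) = m + (f.natDegree - j) * p := by
    intro j hj hj1
    have hne : ∀ a, a ≠ 0 → (f.coeff j).eval a ≠ 0 := by
      intro a ha h0
      have := hp (log a) j
      rw [exp_log ha, h0, mul_zero] at this
      exact mul_ne_zero (h a ha).1 (mul_ne_zero hj1 (pow_ne_zero _ (exp_ne_zero _))) this.symm
    obtain ⟨d, i, hd, hi⟩ := exists_eq_C_mul_X_pow_of_eval_ne_zero hne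
    refine ⟨d, i, hi, exponent_eq_of_forall_exp_eq fun z ↦ ?_⟩
    have := hp z j
    simp only [hi, hm, eval_mul, eval_C, eval_pow, eval_X, one_pow, mul_one] at this
    rw [add_mul, exp_add, exp_nat_mul, exp_nat_mul, ← Nat.cast_sub hj, mul_assoc, exp_nat_mul]
    refine mul_left_cancel₀ (mul_ne_zero hc hd) ?_
    linear_combination this
  have h01 : (f.coeff 0).eval 1 ≠ 0 := fun h0 ↦ (h 1 one_ne_zero).2
    ⟨0, by rw [evalXY, ← coeff_zero_eq_eval_zero, coeff_map]; exact h0, zero_mul _⟩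
  obtain ⟨d, k, hd, hk⟩ := hmono (Nat.zero_le _) h01
  have hj1 : ∀ j, f.coeff j ≠ 0 → (f.coeff j).eval 1 ≠ 0 := by
    intro j hj h0
    refine hj (eq_zero_of_infinite_isRoot _ ((Set.finite_singleton (0 : ℂ)).infinite_compl.mono
      fun a ha ↦ ?_))
    have := hp (log a) j
    rw [exp_log ha, h0, zero_mul, mul_zero] at this
    exact (mul_eq_zero.1 this).resolve_left (h 1 one_ne_zero).1
  rcases eq_or_ne f.natDegree 0 with hn | hn
  · refine ⟨k, 1, 0, one_ne_zero, fun i j hij ↦ ?_⟩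
    have hj : j = 0 := by
      by_contra hj
      exact hij (by rw [coeff_eq_zero_of_natDegree_lt (p := f) (by omega), coeff_zero])
    rw [hj, hd, coeff_C_mul_X_pow] at hij
    have : i = k := by
      by_contra hik
      exact hij (if_neg hik)
    simp [this]
  · refine ⟨f.natDegree * k, f.natDegree, k - m, by exact_mod_cast hn, fun i j hij ↦ ?_⟩
    have hj0 : f.coeff j ≠ 0 := fun h0 ↦ hij (by rw [h0, coeff_zero])
    obtain ⟨e, l, hl, hlp⟩ := hmono (le_natDegree_of_ne_zero hj0) (hj1 j hj0)
    rw [hl, coeff_C_mul_X_pow] at hij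
    have hil : i = l := by
      by_contra hil
      exact hij (if_neg hil)
    have : (f.natDegree * i + (k - m) * j : ℂ) = f.natDegree * k := by
      rw [hil]
      push_cast at hk
      linear_combination (f.natDegree : ℂ) * hlp + (j - f.natDegree : ℂ) * hk
    exact_mod_cast this

end NoCommonZero

/-- Main theorem, equivalence (A) ⇔ (C): for a reduced (squarefree) bivariate polynomial
`f = Σ_{i=0}^n f_i(x) y^i` with `f₀ ≠ 0` and `f_n ≠ 0`, quasi-homogeneity with nonzero
weight of `x` is equivalent to: for every `a ∈ ℂ^×`, `f_n(a) ≠ 0` and there is no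
`b ∈ ℂ` with `f(a,b) = 0` and `b ⬝ (∂f/∂y)(a,b) = 0`. -/
theorem quasiHomogeneous_iff_no_common_zero
    (f : Polynomial (Polynomial ℂ)) (n : ℕ) (hn : n = f.natDegree)
    (hsf : Squarefree f) (h0 : f.coeff 0 ≠ 0) (hN : f.coeff n ≠ 0) :
    (∃ w α β : ℤ, α ≠ 0 ∧
        ∀ i j : ℕ, (f.coeff j).coeff i ≠ 0 → α * (i : ℤ) + β * (j : ℤ) = w) ↔
      (∀ a : ℂ, a ≠ 0 →
        (f.coeff n).eval a ≠ 0 ∧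
          ¬ ∃ b : ℂ, evalXY a b f = 0 ∧ b * evalXY a b (derivative f) = 0) := by
  subst hn
  constructor
  · rintro ⟨w, α, β, hα, hf⟩ a ha
    have hf' : IsQuasiHomogeneous w α β f := hf
    exact ⟨hf'.eval_coeff_ne_zero hα hN ha, hf'.not_exists_common_zero hα hsf h0 ha⟩
  · exact exists_isQuasiHomogeneous_of_not_exists_common_zero
end

section
/- Let f ∈ ℂ[x,y] be a quasi-homogeneous polynomial of type (w; α, β) with α > 0, β ≥ 0, and α, β coprime. Then there exist natural numbers k, ℓ, d ≥ 0 and nonzero complex numbers c, a₁, …, a_d such that f = c·x^k·y^ℓ·∏_{i=1}^d (a_i·x^β − y^α) in ℂ[x,y]. -/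
open Polynomial

open Finset in
/-- Over an algebraically closed field, a homogenized polynomial with nonzero constant term
splits into linear forms with nonzero coefficients. -/
lemma Polynomial.exists_aeval_homogenize_eq_prod {K A : Type*} [Field K] [IsAlgClosed K]
    [CommRing A] [Algebra K A] {g : K[X]} (hg : g.coeff 0 ≠ 0) (u v : A) :
    ∃ (c : K) (a : Fin g.natDegree → K), c ≠ 0 ∧ (∀ i, a i ≠ 0) ∧
      MvPolynomial.aeval ![u, v] (g.homogenize g.natDegree) =
        algebraMap K A c * ∏ i, (algebraMap K A (a i) * v - u) := by
  have hg0 : g ≠ 0 := by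
    rintro rfl
    simp at hg
  have hsplit : g.Splits := IsAlgClosed.splits g
  have hcard : g.roots.toList.length = g.natDegree := by
    rw [Multiset.length_toList, hsplit.natDegree_eq_card_roots]
  let a : Fin g.natDegree → K := fun i ↦ g.roots.toList.get (i.cast hcard.symm)
  have hfac : g = C ((-1) ^ g.natDegree * g.leadingCoeff) * ∏ i, (C (a i) - X) := by
    have hprod : ∏ i, (X - C (a i)) = (g.roots.map (X - C ·)).prod := by
      rw [← Multiset.coe_toList g.roots, Multiset.map_coe, Multiset.prod_coe,
        ← List.prod_ofFn]
      congr 1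
      apply List.ext_get <;> simp [a, ← hsplit.natDegree_eq_card_roots]
    have hneg : ∏ i, (C (a i) - X) = (-1) ^ g.natDegree * ∏ i, (X - C (a i)) := by
      simp_rw [← neg_sub X (C (a _)), Finset.prod_neg, Finset.card_univ, Fintype.card_fin]
    rw [hneg, hprod]
    conv_lhs => rw [hsplit.eq_prod_roots]
    simp only [map_mul, map_pow, map_neg, map_one]
    have hsq : ((-1 : K[X]) ^ g.natDegree) * (-1) ^ g.natDegree = 1 := by
      rw [← mul_pow]
      simp
    linear_combination (-C g.leadingCoeff * (g.roots.map (X - C ·)).prod) * hsq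
  refine ⟨(-1) ^ g.natDegree * g.leadingCoeff, a, ?_, fun i hi ↦ hg ?_, ?_⟩
  · simpa using hg0
  · have hmem : a i ∈ g.roots := Multiset.mem_toList.mp (List.get_mem _ _)
    rw [hi, mem_roots hg0, IsRoot.def] at hmem
    rwa [coeff_zero_eq_eval_zero]
  · have hdeg : ∀ i ∈ univ, (C (a i) - X).natDegree ≤ 1 := fun i _ ↦ by compute_degree
    have hhom := homogenize_finsetProd hdeg
    simp only [sum_const, card_univ, Fintype.card_fin, smul_eq_mul, mul_one] at hhom
    conv_lhs => rw [show g.homogenize g.natDegree = _ from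
      congrArg (Polynomial.homogenize · g.natDegree) hfac]
    simp only [homogenize_C_mul, hhom]
    simp

/-- Two solutions of `m * i + n * j = w` with `m`, `n` coprime differ by a multiple of
`(-n, m)`. -/
lemma Nat.Coprime.exists_eq_add_mul_of_add_eq {m n : ℕ} (hm : 0 < m) (hmn : m.Coprime n)
    {i j i' j' : ℕ} (hj : j ≤ j') (h : m * i + n * j = m * i' + n * j') :
    ∃ t, j' = j + m * t ∧ i = i' + n * t := by
  obtain ⟨d, rfl⟩ := Nat.exists_eq_add_of_le hj
  have hdvd : m ∣ n * d := by
    refine (Nat.dvd_add_right (_root_.dvd_mul_right m i')).mp ⟨i, ?_⟩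
    linarith
  obtain ⟨t, rfl⟩ := hmn.dvd_of_dvd_mul_left hdvd
  refine ⟨t, rfl, Nat.eq_of_mul_eq_mul_left hm ?_⟩
  linarith

/-- A nonzero polynomial in `R[X][X]` whose monomials lie on the line `m * i + n * j = w` is a
monomial times a homogeneous form in `X ^ m` and `C X ^ n` with nonzero extreme coefficients. -/
lemma Polynomial.exists_eq_aeval_homogenize_of_support {R : Type*} [CommRing R]
    {f : R[X][X]} (hf : f ≠ 0) {m n w : ℕ} (hm : 0 < m) (hmn : m.Coprime n)
    (h : ∀ i j, (f.coeff j).coeff i ≠ 0 → m * i + n * j = w) :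
    ∃ (k l : ℕ) (g : R[X]), g.coeff 0 ≠ 0 ∧
      f = C (X ^ k) * X ^ l *
        MvPolynomial.aeval ![(X ^ m : R[X][X]), C (X ^ n)] (g.homogenize g.natDegree) := by
  have hexists : ∀ j, f.coeff j ≠ 0 → ∃ i, (f.coeff j).coeff i ≠ 0 := fun j hj ↦ by
    by_contra! hzero
    exact hj (Polynomial.ext (by simpa using hzero))
  obtain ⟨k, hk⟩ := hexists f.natDegree (by simpa using hf)
  obtain ⟨i₀, hi₀⟩ := hexists f.natTrailingDegree (by
    rwa [← trailingCoeff, ne_eq, trailingCoeff_eq_zero])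
  set l := f.natTrailingDegree
  obtain ⟨D, hD, rfl⟩ := hmn.exists_eq_add_mul_of_add_eq hm
    (natTrailingDegree_le_natDegree f) ((h _ _ hi₀).trans (h _ _ hk).symm)
  let b : ℕ → R := fun t ↦ (f.coeff (l + m * t)).coeff (k + n * (D - t))
  let g : R[X] := ∑ t ∈ Finset.range (D + 1), monomial t (b t)
  have hgcoeff : ∀ t ≤ D, g.coeff t = b t := fun t ht ↦ by
    simp [g, coeff_monomial, Nat.lt_succ_of_le ht]
  have hgdeg : g.natDegree = D := by
    refine natDegree_eq_of_le_of_coeff_ne_zero ?_ ?_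
    · exact natDegree_sum_le_of_forall_le _ _ fun t ht ↦
        (natDegree_monomial_le _).trans (Nat.lt_succ_iff.mp (Finset.mem_range.mp ht))
    · rw [hgcoeff D le_rfl]
      simpa only [b, Nat.sub_self, mul_zero, add_zero, l, ← hD] using hk
  refine ⟨k, l, g, by simpa [hgcoeff 0 (Nat.zero_le D), b] using hi₀, ?_⟩
  have hsum : f = ∑ p ∈ Finset.HasAntidiagonal.antidiagonal D,
      monomial (l + m * p.1) (monomial (k + n * p.2) (b p.1)) := by
    ext j i
    simp only [finsetSum_coeff]
    by_cases hij : (f.coeff j).coeff i = 0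
    · rw [hij, Finset.sum_eq_zero]
      rintro ⟨t, s⟩ hts
      rw [Finset.HasAntidiagonal.mem_antidiagonal] at hts
      have hs : D - t = s := by omega
      simp only [coeff_monomial]
      split_ifs with hj
      · rw [coeff_monomial]
        split_ifs with hi
        · simpa [b, hs, hj, hi] using hij
        · rfl
      · simp
    · have hjl : l ≤ j := natTrailingDegree_le_of_ne_zero fun h0 ↦ hij (by simp [h0])
      have hjN : j ≤ f.natDegree := le_natDegree_of_ne_zero fun h0 ↦ hij (by simp [h0])
      obtain ⟨t, rfl, ht⟩ := hmn.exists_eq_add_mul_of_add_eq hm hjl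
        ((h _ _ hi₀).trans (h _ _ hij).symm)
      obtain ⟨s, hs, rfl⟩ := hmn.exists_eq_add_mul_of_add_eq hm hjN
        ((h _ _ hij).trans (h _ _ hk).symm)
      have hts : t + s = D := Nat.eq_of_mul_eq_mul_left hm (by linarith)
      have hs' : D - t = s := by omega
      rw [Finset.sum_eq_single (t, s)]
      · simp [b, hs']
      · rintro ⟨t', s'⟩ hts' hne
        rw [Finset.HasAntidiagonal.mem_antidiagonal] at hts'
        rw [coeff_monomial, if_neg, coeff_zero]
        intro heq
        have htt : t' = t := Nat.eq_of_mul_eq_mul_left hm (Nat.add_left_cancel heq)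
        exact hne (Prod.ext htt (by simp only at hts' ⊢; omega))
      · simp [hts]
  conv_lhs => rw [hsum]
  rw [hgdeg, homogenize, map_sum, Finset.mul_sum]
  refine Finset.sum_congr rfl fun p hp ↦ ?_
  have hpD : p.1 ≤ D := by
    rw [Finset.HasAntidiagonal.mem_antidiagonal] at hp
    omega
  rw [hgcoeff _ hpD, MvPolynomial.aeval_monomial]
  simp only [← C_mul_X_pow_eq_monomial]
  rw [Finsupp.prod_fintype _ _ (by simp), Fin.prod_univ_two]
  simp [algebraMap_apply, pow_add, pow_mul]
  ring

/-- Factorization of a (nonzero) quasi-homogeneous polynomial of type `(w; α, β)` with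
`α > 0`, `β ≥ 0` and `α, β` coprime: `f = c·x^k·y^ℓ·∏_{i=1}^d (a_i x^β - y^α)`.
Here `f ∈ ℂ[x][y]` with `x` the inner variable and `y` the outer one, so the monomial
`x^i y^j` appears with coefficient `(f.coeff j).coeff i`. -/
theorem quasiHomogeneous_factorization_nonneg_weight
    (f : Polynomial (Polynomial ℂ)) (hf : f ≠ 0) (w α β : ℤ)
    (hα : 0 < α) (hβ : 0 ≤ β) (hcop : IsCoprime α β)
    (hqh : ∀ i j : ℕ, (f.coeff j).coeff i ≠ 0 → α * (i : ℤ) + β * (j : ℤ) = w) :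
    ∃ (k ℓ d : ℕ) (c : ℂ) (a : Fin d → ℂ), c ≠ 0 ∧ (∀ i, a i ≠ 0) ∧
      f = Polynomial.C (Polynomial.C c * Polynomial.X ^ k) * Polynomial.X ^ ℓ *
        ∏ i : Fin d,
          (Polynomial.C (Polynomial.C (a i) * Polynomial.X ^ β.toNat)
            - Polynomial.X ^ α.toNat) := by
  lift α to ℕ using hα.le
  lift β to ℕ using hβ
  obtain ⟨v, rfl⟩ : ∃ v : ℕ, w = v := by
    have hne : ∃ j i, (f.coeff j).coeff i ≠ 0 := by
      by_contra! hzero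
      exact hf (by ext j i; simpa using hzero j i)
    obtain ⟨j, i, hij⟩ := hne
    exact ⟨α * i + β * j, by rw [← hqh i j hij]; push_cast; rfl⟩
  obtain ⟨k, l, g, hg, hfg⟩ := exists_eq_aeval_homogenize_of_support hf
    (by exact_mod_cast hα) (Nat.isCoprime_iff_coprime.mp hcop)
    fun i j hij ↦ by exact_mod_cast hqh i j hij
  obtain ⟨c, a, hc, ha, hprod⟩ := exists_aeval_homogenize_eq_prod hg
    ((X : ℂ[X][X]) ^ α) (C (X ^ β))
  refine ⟨k, l, g.natDegree, c, a, hc, ha, ?_⟩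
  rw [hprod] at hfg
  rw [hfg]
  simp only [Polynomial.algebraMap_apply, Algebra.algebraMap_self, RingHom.id_apply, Int.toNat_natCast,
    map_mul, map_pow]
  ring
end

section
/- Let f ∈ ℂ[x,y] be a quasi-homogeneous polynomial of type (w; α, β) with α > 0, β ≤ 0, and α, β coprime. Then there exist natural numbers k, ℓ, d ≥ 0 and nonzero complex numbers c, a₁, …, a_d such that f = c·x^k·y^ℓ·∏_{i=1}^d (a_i − x^{−β}·y^α) in ℂ[x,y] (note −β ≥ 0, so each factor is a polynomial). -/
open Polynomial

/-- `F` is a nonzero scalar times a monomial times a product of factors `a - x ^ m * y ^ n`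
with every `a` nonzero. -/
def IsMonomialMulBinomials (m n : ℕ) (F : ℂ[X][X]) : Prop :=
  ∃ (k ℓ d : ℕ) (c : ℂ) (a : Fin d → ℂ), c ≠ 0 ∧ (∀ i, a i ≠ 0) ∧
    F = C (C c * X ^ k) * X ^ ℓ * ∏ i : Fin d, (C (C (a i)) - C (X ^ m) * X ^ n)

namespace IsMonomialMulBinomials

variable {m n : ℕ} {F : ℂ[X][X]}

theorem const {c : ℂ} (hc : c ≠ 0) : IsMonomialMulBinomials m n (C (C c)) :=
  ⟨0, 0, 0, c, Fin.elim0, hc, fun i => i.elim0, by simp⟩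

theorem monomial_mul (hF : IsMonomialMulBinomials m n F) (i j : ℕ) :
    IsMonomialMulBinomials m n (C (X ^ i) * X ^ j * F) := by
  obtain ⟨k, ℓ, d, c, a, hc, ha, rfl⟩ := hF
  refine ⟨i + k, j + ℓ, d, c, a, hc, ha, ?_⟩
  simp only [C_mul, pow_add]
  ring

theorem sub_const_mul (hF : IsMonomialMulBinomials m n F) (r : ℂ) :
    IsMonomialMulBinomials m n ((C (X ^ m) * X ^ n - C (C r)) * F) := by
  rcases eq_or_ne r 0 with rfl | hr
  · simpa using hF.monomial_mul m n
  · obtain ⟨k, ℓ, d, c, a, hc, ha, rfl⟩ := hF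
    refine ⟨k, ℓ, d + 1, -c, Fin.cons r a, neg_ne_zero.mpr hc, ?_, ?_⟩
    · exact Fin.cases hr ha
    · simp only [Fin.prod_univ_succ, Fin.cons_zero, Fin.cons_succ, C_mul, C_neg]
      ring

theorem aeval {g : ℂ[X]} (hg : g ≠ 0) :
    IsMonomialMulBinomials m n (Polynomial.aeval (C (X ^ m) * X ^ n : ℂ[X][X]) g) := by
  have hprod (s : Multiset ℂ) : IsMonomialMulBinomials m n
      (Polynomial.aeval (C (X ^ m) * X ^ n : ℂ[X][X])
        (C g.leadingCoeff * (s.map fun r => X - C r).prod)) := by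
    induction s using Multiset.induction_on with
    | empty =>
      simpa [Polynomial.algebraMap_apply] using const (leadingCoeff_ne_zero.mpr hg)
    | cons r s ih =>
      rw [Multiset.map_cons, Multiset.prod_cons, mul_left_comm, map_mul]
      simpa [Polynomial.algebraMap_apply] using ih.sub_const_mul r
  have h := hprod g.roots
  rwa [← (IsAlgClosed.splits g).eq_prod_roots] at h

end IsMonomialMulBinomials

/-- If every monomial of `f` is `x ^ (p + m * t) * y ^ (q + n * t)` for some `t`, then `f` is
`x ^ p * y ^ q` times a polynomial in `x ^ m * y ^ n`. -/
theorem exists_eq_monomial_mul_aeval {R : Type*} [CommRing R] (f : R[X][X]) (p q m n : ℕ)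
    (h : ∀ i j, (f.coeff j).coeff i ≠ 0 → ∃ t, i = p + m * t ∧ j = q + n * t) :
    ∃ g : R[X], f = C (X ^ p) * X ^ q * aeval (C (X ^ m) * X ^ n : R[X][X]) g := by
  have hsum {ι : Type} (s : Finset ι) (F : ι → R[X][X])
      (hF : ∀ i ∈ s, ∃ g : R[X], F i = C (X ^ p) * X ^ q * aeval (C (X ^ m) * X ^ n : R[X][X]) g) :
      ∃ g : R[X], ∑ i ∈ s, F i = C (X ^ p) * X ^ q * aeval (C (X ^ m) * X ^ n : R[X][X]) g := by
    refine Finset.sum_induction F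
      (fun F => ∃ g : R[X], F = C (X ^ p) * X ^ q * aeval (C (X ^ m) * X ^ n : R[X][X]) g)
      ?_ ⟨0, by simp⟩ hF
    rintro _ _ ⟨g₁, rfl⟩ ⟨g₂, rfl⟩
    exact ⟨g₁ + g₂, by rw [map_add, mul_add]⟩
  rw [f.as_sum_support_C_mul_X_pow]
  refine hsum _ _ fun j _ => ?_
  rw [(f.coeff j).as_sum_support_C_mul_X_pow, map_sum, Finset.sum_mul]
  refine hsum _ _ fun i hi => ?_
  obtain ⟨t, hit, hjt⟩ := h i j (mem_support_iff.mp hi)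
  refine ⟨C ((f.coeff j).coeff i) * X ^ t, ?_⟩
  generalize (f.coeff j).coeff i = c
  subst hit hjt
  simp only [map_mul, map_pow, aeval_X, aeval_C, Polynomial.algebraMap_apply,
    Algebra.algebraMap_self, RingHom.id_apply]
  ring

/-- Factorization of a (nonzero) quasi-homogeneous polynomial of type `(w; α, β)` with
`α > 0`, `β ≤ 0` and `α, β` coprime: `f = c·x^k·y^ℓ·∏_{i=1}^d (a_i - x^{-β} y^α)`.
Here `f ∈ ℂ[x][y]` with `x` the inner variable and `y` the outer one, so the monomial
`x^i y^j` appears with coefficient `(f.coeff j).coeff i`. -/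
theorem quasiHomogeneous_factorization_nonpos_weight
    (f : Polynomial (Polynomial ℂ)) (hf : f ≠ 0) (w α β : ℤ)
    (hα : 0 < α) (hβ : β ≤ 0) (hcop : IsCoprime α β)
    (hqh : ∀ i j : ℕ, (f.coeff j).coeff i ≠ 0 → α * (i : ℤ) + β * (j : ℤ) = w) :
    ∃ (k ℓ d : ℕ) (c : ℂ) (a : Fin d → ℂ), c ≠ 0 ∧ (∀ i, a i ≠ 0) ∧
      f = Polynomial.C (Polynomial.C c * Polynomial.X ^ k) * Polynomial.X ^ ℓ *
        ∏ i : Fin d,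
          (Polynomial.C (Polynomial.C (a i))
            - Polynomial.C (Polynomial.X ^ (-β).toNat) * Polynomial.X ^ α.toNat) := by
  obtain ⟨n, rfl⟩ := Int.eq_ofNat_of_zero_le hα.le
  obtain ⟨m, hm⟩ := Int.eq_ofNat_of_zero_le (neg_nonneg.mpr hβ)
  obtain rfl : β = -(m : ℤ) := by omega
  obtain ⟨p, hp⟩ : ∃ p, (f.coeff f.natTrailingDegree).coeff p ≠ 0 := by
    by_contra! h
    exact hf (trailingCoeff_eq_zero.mp (Polynomial.ext h))
  have hmon : ∀ i j, (f.coeff j).coeff i ≠ 0 →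
      ∃ t, i = p + m * t ∧ j = f.natTrailingDegree + n * t := by
    intro i j hij
    have hj : f.natTrailingDegree ≤ j :=
      natTrailingDegree_le_of_ne_zero fun h => hij (by simp [h])
    have hline : (n : ℤ) * (i - p) = m * (j - f.natTrailingDegree) := by
      linear_combination hqh i j hij - hqh p _ hp
    have hdvd : (n : ℤ) ∣ j - f.natTrailingDegree :=
      hcop.neg_right.dvd_of_dvd_mul_left (by rw [neg_neg, ← hline]; exact dvd_mul_right _ _)
    obtain ⟨t, ht⟩ := hdvd
    have ht0 : 0 ≤ t := nonneg_of_mul_nonneg_right (by rw [← ht]; omega) hα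
    lift t to ℕ using ht0
    have hi : (i : ℤ) - p = m * t :=
      mul_left_cancel₀ hα.ne' (by rw [hline, ht]; ring)
    refine ⟨t, ?_, ?_⟩ <;> zify <;> linarith
  obtain ⟨g, hg⟩ := exists_eq_monomial_mul_aeval f p _ m n hmon
  have hg0 : g ≠ 0 := by
    rintro rfl
    exact hf (by simpa using hg)
  have hfac := (IsMonomialMulBinomials.aeval (m := m) (n := n) hg0).monomial_mul
    p f.natTrailingDegree
  rw [← hg] at hfac
  simpa only [IsMonomialMulBinomials, neg_neg, Int.toNat_natCast] using hfac
end

section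
/- Let g, h ∈ ℂ[x,y] be polynomials, neither of which is a monomial (i.e. each has at least two monomials with nonzero coefficient). Suppose g is quasi-homogeneous of type (w; α, β) with α > 0 and h is quasi-homogeneous of type (w'; γ, δ) with γ > 0, and suppose β·γ ≠ α·δ. Then there exist x₀, y₀ ∈ ℂ, both nonzero, such that g(x₀, y₀) = 0 and h(x₀, y₀) = 0. -/
open MvPolynomial

/-- A complex polynomial with at least two monomials has a nonzero root. -/
theorem Polynomial.exists_ne_zero_isRoot_of_two_le_card_support (p : Polynomial ℂ)
    (hp : 2 ≤ p.support.card) : ∃ z : ℂ, z ≠ 0 ∧ p.IsRoot z := by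
  by_contra! H
  have hp0 : p ≠ 0 := by rintro rfl; simp at hp
  have hroots : p.roots = Multiset.replicate (Multiset.card p.roots) 0 :=
    Multiset.eq_replicate_card.2 fun z hz ↦ by
      by_contra hz0
      exact H z hz0 ((Polynomial.mem_roots hp0).1 hz)
  have hprod := (IsAlgClosed.splits p).eq_prod_roots
  rw [hroots] at hprod
  simp only [Multiset.map_replicate, Multiset.prod_replicate, map_zero, sub_zero] at hprod
  have hcard := Polynomial.card_support_C_mul_X_pow_le_one
    (c := p.leadingCoeff) (n := Multiset.card p.roots)
  rw [← hprod] at hcard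
  omega

/-- If the monomials of a bivariate polynomial are determined by their exponent of the second
variable and there are at least two of them, then the polynomial has a zero `(1, z)`, `z ≠ 0`. -/
theorem MvPolynomial.exists_eval_one_eq_zero (g : MvPolynomial (Fin 2) ℂ)
    (hg : 2 ≤ g.support.card) (hinj : Set.InjOn (fun m : Fin 2 →₀ ℕ ↦ m 1) g.support) :
    ∃ z : ℂ, z ≠ 0 ∧ eval ![1, z] g = 0 := by
  let p : Polynomial ℂ := ∑ m ∈ g.support, Polynomial.monomial (m 1) (g.coeff m)
  have hp : p = ∑ m ∈ g.support, Polynomial.monomial (m 1) (g.coeff m) := rfl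
  have hsub : g.support.image (fun m ↦ m 1) ⊆ p.support := by
    intro n hn
    obtain ⟨m, hm, rfl⟩ := Finset.mem_image.1 hn
    have hcoeff : p.coeff (m 1) = g.coeff m := by
      rw [hp, Polynomial.finsetSum_coeff, Finset.sum_eq_single_of_mem m hm]
      · simp
      · intro k hk hkm
        exact Polynomial.coeff_monomial_of_ne _ fun h ↦ hkm (hinj hk hm h.symm)
    rw [Polynomial.mem_support_iff, hcoeff]
    exact mem_support_iff.1 hm
  have hcard := Finset.card_le_card hsub
  rw [Finset.card_image_of_injOn hinj] at hcard
  obtain ⟨z, hz, hroot⟩ :=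
    p.exists_ne_zero_isRoot_of_two_le_card_support (hg.trans hcard)
  refine ⟨z, hz, ?_⟩
  rw [Polynomial.IsRoot, hp, Polynomial.eval_finsetSum] at hroot
  simpa [eval_eq'] using hroot

/-- The zero set of a quasi-homogeneous polynomial with at least two monomials contains an orbit
of the corresponding one-parameter action on the torus. -/
theorem MvPolynomial.exists_forall_eval_exp_eq_zero (g : MvPolynomial (Fin 2) ℂ)
    (hg : 2 ≤ g.support.card) (w α β : ℤ) (hα : 0 < α)
    (hq : ∀ m ∈ g.support, α * (m 0 : ℤ) + β * (m 1 : ℤ) = w) :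
    ∃ b : ℂ, ∀ u : ℂ, eval ![Complex.exp (α * u), Complex.exp (β * u + b)] g = 0 := by
  have hinj : Set.InjOn (fun m : Fin 2 →₀ ℕ ↦ m 1) g.support := by
    intro m hm k hk (hmk : m 1 = k 1)
    have h := (hq m hm).trans (hq k hk).symm
    rw [hmk, add_left_inj, mul_right_inj' hα.ne'] at h
    ext i
    fin_cases i
    · exact_mod_cast h
    · exact hmk
  obtain ⟨z, hz, hroot⟩ := g.exists_eval_one_eq_zero hg hinj
  refine ⟨Complex.log z, fun u ↦ ?_⟩
  suffices eval ![Complex.exp (α * u), Complex.exp (β * u + Complex.log z)] g =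
      Complex.exp (w * u) * eval ![1, z] g by rw [this, hroot, mul_zero]
  rw [eval_eq', eval_eq', Finset.mul_sum]
  refine Finset.sum_congr rfl fun m hm ↦ ?_
  have hw : (w : ℂ) * u = m 0 * (α * u) + m 1 * (β * u) := by
    rw [← hq m hm]
    push_cast
    ring
  simp only [Fin.prod_univ_two, Matrix.cons_val_zero, Matrix.cons_val_one, one_pow, one_mul]
  rw [hw, Complex.exp_add (β * u), Complex.exp_log hz, Complex.exp_add, Complex.exp_nat_mul,
    Complex.exp_nat_mul]
  ring

/-- Two quasi-homogeneous polynomials, neither of which is a monomial, whose weight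
vectors are not proportional, have a common zero in `(ℂ^×)²`. -/
theorem common_zero_of_different_weights
    (g h : MvPolynomial (Fin 2) ℂ)
    (hg2 : 2 ≤ g.support.card) (hh2 : 2 ≤ h.support.card)
    (w w' α β γ δ : ℤ) (hα : 0 < α) (hγ : 0 < γ)
    (hqg : ∀ m ∈ g.support, α * (m 0 : ℤ) + β * (m 1 : ℤ) = w)
    (hqh : ∀ m ∈ h.support, γ * (m 0 : ℤ) + δ * (m 1 : ℤ) = w')
    (hslope : β * γ ≠ α * δ) :
    ∃ x₀ y₀ : ℂ, x₀ ≠ 0 ∧ y₀ ≠ 0 ∧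
      eval ![x₀, y₀] g = 0 ∧ eval ![x₀, y₀] h = 0 := by
  obtain ⟨b, hb⟩ := g.exists_forall_eval_exp_eq_zero hg2 w α β hα hqg
  obtain ⟨d, hd⟩ := h.exists_forall_eval_exp_eq_zero hh2 w' γ δ hγ hqh
  have hD : (β * γ - α * δ : ℂ) ≠ 0 := sub_ne_zero.2 (by exact_mod_cast hslope)
  let c : ℂ := (d - b) / (β * γ - α * δ)
  have hcD : c * (β * γ - α * δ) = d - b := div_mul_cancel₀ _ hD
  refine ⟨_, _, Complex.exp_ne_zero _, Complex.exp_ne_zero _, hb (γ * c), ?_⟩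
  have hx : (α : ℂ) * (γ * c) = γ * (α * c) := by ring
  have hy : (β : ℂ) * (γ * c) + b = δ * (α * c) + d := by linear_combination hcD
  rw [hx, hy]
  exact hd _
end

section
/- Let f ∈ ℂ[x,y] be an irreducible (in particular nonconstant) polynomial. Suppose there exists c ∈ ℂ such that for every (a, b) ∈ ℂ² with f(a,b) = 0 one has b·(∂f/∂y)(a,b) = c·a·(∂f/∂x)(a,b). Then f is quasi-homogeneous: there exist integers w, α, β with (α, β) ≠ (0, 0) such that α·i + β·j = w for every monomial x^i y^j appearing in f with nonzero coefficient. -/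
open MvPolynomial

namespace MvPolynomial

variable {σ R : Type*}

theorem coeff_X_mul_pderiv [CommSemiring R] (i : σ) (f : MvPolynomial σ R) (m : σ →₀ ℕ) :
    coeff m (X i * pderiv i f) = m i * coeff m f := by
  classical
  rw [coeff_X_mul', coeff_pderiv]
  split_ifs with h
  · have hi : 1 ≤ m i := Nat.one_le_iff_ne_zero.mpr (Finsupp.mem_support_iff.mp h)
    have hm : m - Finsupp.single i 1 + Finsupp.single i 1 = m :=
      tsub_add_cancel_of_le (Finsupp.single_le_iff.mpr hi)
    have hmi : (m - Finsupp.single i 1 : σ →₀ ℕ) i + 1 = m i := by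
      rw [Finsupp.tsub_apply, Finsupp.single_eq_same, Nat.sub_add_cancel hi]
    rw [hm, ← hmi, Nat.cast_succ, mul_comm]
  · simp [Finsupp.notMem_support_iff.mp h]

theorem exists_eq_C_mul_of_dvd_of_support_subset [CommRing R] [IsDomain R]
    {f g : MvPolynomial σ R} (hfg : f ∣ g) (hsupp : g.support ⊆ f.support) :
    ∃ a : R, g = C a * f := by
  obtain ⟨h, rfl⟩ := hfg
  by_cases h0 : f * h = 0
  · exact ⟨0, by simp [h0]⟩
  · have hdeg : (f * h).totalDegree ≤ f.totalDegree :=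
      totalDegree_le_of_support_subset hsupp
    rw [totalDegree_mul_of_isDomain (left_ne_zero_of_mul h0) (right_ne_zero_of_mul h0)] at hdeg
    have hh := totalDegree_eq_zero_iff_eq_C.mp (show h.totalDegree = 0 by omega)
    exact ⟨coeff 0 h, by rw [← hh, mul_comm]⟩

theorem dvd_of_forall_eval_eq_zero {k : Type*} [Field k] [IsAlgClosed k] [Finite σ]
    {f g : MvPolynomial σ k} (hf : Irreducible f)
    (h : ∀ x : σ → k, eval x f = 0 → eval x g = 0) : f ∣ g := by
  have hprime : (Ideal.span {f}).IsPrime :=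
    (Ideal.span_singleton_prime hf.ne_zero).mpr hf.prime
  rw [← Ideal.mem_span_singleton, ← IsPrime.vanishingIdeal_zeroLocus (K := k) (Ideal.span {f})]
  intro x hx
  simpa [aeval_eq_eval] using h x (by
    simpa [aeval_eq_eval] using hx f (Ideal.mem_span_singleton_self f))

end MvPolynomial

/-- If `f` is irreducible and the rational function `y·f_y / (x·f_x)` is constant (equal
to `c`) on the curve `f = 0`, then `f` is quasi-homogeneous. -/
theorem quasiHomogeneous_of_constant_ratio_on_curve
    (f : MvPolynomial (Fin 2) ℂ) (hf : Irreducible f) (c : ℂ)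
    (hc : ∀ a b : ℂ, eval ![a, b] f = 0 →
      b * eval ![a, b] (pderiv 1 f) = c * (a * eval ![a, b] (pderiv 0 f))) :
    ∃ w α β : ℤ, ¬(α = 0 ∧ β = 0) ∧
      ∀ m ∈ f.support, α * (m 0 : ℤ) + β * (m 1 : ℤ) = w := by
  set g := X 1 * pderiv 1 f - C c * (X 0 * pderiv 0 f) with hg
  have hcoeff (m : Fin 2 →₀ ℕ) : coeff m g = ((m 1 : ℂ) - c * m 0) * coeff m f := by
    rw [hg, coeff_sub, coeff_C_mul, coeff_X_mul_pderiv, coeff_X_mul_pderiv]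
    ring
  have hdvd : f ∣ g := by
    refine dvd_of_forall_eval_eq_zero hf fun x hx => ?_
    have hx' : x = ![x 0, x 1] := by
      ext i
      fin_cases i <;> rfl
    have hzero := hc (x 0) (x 1) (by rwa [← hx'])
    rw [← hx'] at hzero
    simp [hg, hzero]
  obtain ⟨a, ha⟩ := exists_eq_C_mul_of_dvd_of_support_subset hdvd fun m hm => by
    rw [mem_support_iff, hcoeff] at hm
    exact mem_support_iff.mpr (right_ne_zero_of_mul hm)
  have hline : ∀ m ∈ f.support, (m 1 : ℂ) - c * m 0 = a := fun m hm =>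
    mul_right_cancel₀ (mem_support_iff.mp hm) (by rw [← hcoeff, ha, coeff_C_mul])
  obtain ⟨m, hm⟩ := support_nonempty.mpr hf.ne_zero
  by_cases hconst : ∀ n ∈ f.support, n 0 = m 0
  · exact ⟨m 0, 1, 0, by simp, fun n hn => by simp [hconst n hn]⟩
  · push Not at hconst
    obtain ⟨n, hn, hne⟩ := hconst
    refine ⟨((n 1 : ℤ) - m 1) * m 0 + ((m 0 : ℤ) - n 0) * m 1, (n 1 : ℤ) - m 1,
      (m 0 : ℤ) - n 0, by omega, fun p hp => ?_⟩
    have key : (((n 1 : ℂ) - m 1) * p 0 + ((m 0 : ℂ) - n 0) * p 1) =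
        ((n 1 : ℂ) - m 1) * m 0 + ((m 0 : ℂ) - n 0) * m 1 := by
      linear_combination ((p 0 : ℂ) - m 0) * (hline n hn - hline m hm) +
        ((m 0 : ℂ) - n 0) * (hline p hp - hline m hm)
    exact_mod_cast key
end

section
/- Let f ∈ ℂ[x,y] be a polynomial and let s ∈ ℂ⟦t⟧ be a formal power series of finite order M with 1 ≤ M < ∞ (so s ≠ 0 and s has zero constant term). Write F_x, F_y ∈ ℂ⟦t⟧ for the power series obtained from ∂f/∂x and ∂f/∂y by substituting x = t and y = s(t). Assume f(t, s(t)) = 0 in ℂ⟦t⟧ and F_y ≠ 0. Then: (i) the order of t·F_x equals the order of s·F_y, which equals M plus the order of F_y; and (ii) the order of M·s·F_y + t·F_x is strictly greater than M plus the order of F_y. -/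
open MvPolynomial PowerSeries

/-- Chain rule: a derivation applied to a polynomial expression in finitely many elements. -/
theorem MvPolynomial.derivation_aeval {R A σ : Type*} [CommRing R] [CommRing A] [Algebra R A]
    [Fintype σ] (D : Derivation R A A) (g : σ → A) (p : MvPolynomial σ R) :
    D (aeval g p) = ∑ i, aeval g (pderiv i p) * D (g i) := by
  classical
  induction p using MvPolynomial.induction_on with
  | C a => simp
  | add p q hp hq => simp [hp, hq, add_mul, Finset.sum_add_distrib]
  | mul_X p j hp =>
    simp only [map_mul, aeval_X, Derivation.leibniz, hp, smul_eq_mul, map_add, pderiv_X, add_mul,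
      Finset.sum_add_distrib, Finset.mul_sum]
    congr 1
    · rw [Finset.sum_eq_single j]
      · simp
      · intro b _ hb
        simp [Pi.single_eq_of_ne hb.symm]
      · simp
    · exact Finset.sum_congr rfl fun i _ => by ring

theorem PowerSeries.coeff_X_mul_derivative {R : Type*} [CommSemiring R] (s : PowerSeries R)
    (n : ℕ) : coeff n (PowerSeries.X * d⁄dX R s) = n * coeff n s := by
  cases n with
  | zero => simp
  | succ n => simp [coeff_succ_X_mul, coeff_derivative, mul_comm]

theorem PowerSeries.coeff_natCast_mul {R : Type*} [CommSemiring R] (M n : ℕ)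
    (s : PowerSeries R) : coeff n ((M : PowerSeries R) * s) = M * coeff n s := by
  rw [← nsmul_eq_mul, map_nsmul, nsmul_eq_mul]

/-- The Euler operator `X * d⁄dX` preserves a nonzero finite order. -/
theorem PowerSeries.order_X_mul_derivative {R : Type*} [CommSemiring R] [NoZeroDivisors R]
    [CharZero R] {s : PowerSeries R} {M : ℕ} (hM : M ≠ 0) (hs : s.order = M) :
    (PowerSeries.X * d⁄dX R s).order = (M : ℕ∞) := by
  rw [order_eq_nat] at hs ⊢
  refine ⟨?_, fun i hi => ?_⟩
  · rw [coeff_X_mul_derivative]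
    exact mul_ne_zero (Nat.cast_ne_zero.mpr hM) hs.1
  · rw [coeff_X_mul_derivative, hs.2 i hi, mul_zero]

/-- The leading term of a series of order `M` is an eigenvector of the Euler operator
`X * d⁄dX` with eigenvalue `M`. -/
theorem PowerSeries.lt_order_natCast_mul_sub_X_mul_derivative {R : Type*} [CommRing R]
    {s : PowerSeries R} {M : ℕ} (hs : s.order = M) :
    (M : ℕ∞) < ((M : PowerSeries R) * s - PowerSeries.X * d⁄dX R s).order := by
  rw [order_eq_nat] at hs
  refine lt_of_lt_of_le (Nat.cast_lt.mpr M.lt_succ_self) (nat_le_order _ _ fun i hi => ?_)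
  rw [map_sub, coeff_X_mul_derivative, coeff_natCast_mul]
  rcases (Nat.lt_succ_iff.mp hi).lt_or_eq with h | rfl
  · simp [hs.2 i h]
  · exact sub_self _

/-- Order computation along a formal branch `y = s(t)` of `f = 0` through the origin:
writing `F_x = f_x(t, s(t))` and `F_y = f_y(t, s(t))`, and `M = order s` (with
`1 ≤ M < ∞`), one has (i) `order (t·F_x) = order (s·F_y) = M + order F_y`, and
(ii) `order (M·s·F_y + t·F_x) > M + order F_y`. -/
theorem order_along_branch
    (f : MvPolynomial (Fin 2) ℂ) (s : PowerSeries ℂ) (M : ℕ) (hM : 1 ≤ M)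
    (hord : s.order = M)
    (Fx Fy : PowerSeries ℂ)
    (hFx : Fx = MvPolynomial.aeval ![(PowerSeries.X : PowerSeries ℂ), s] (pderiv 0 f))
    (hFy : Fy = MvPolynomial.aeval ![(PowerSeries.X : PowerSeries ℂ), s] (pderiv 1 f))
    (hf : MvPolynomial.aeval ![(PowerSeries.X : PowerSeries ℂ), s] f = 0)
    (hFy0 : Fy ≠ 0) :
    ((PowerSeries.X * Fx).order = (s * Fy).order ∧
        (s * Fy).order = (M : ℕ∞) + Fy.order) ∧
      (M : ℕ∞) + Fy.order < ((M : PowerSeries ℂ) * (s * Fy) + PowerSeries.X * Fx).order := by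
  have hchain := MvPolynomial.derivation_aeval (d⁄dX ℂ) ![(PowerSeries.X : PowerSeries ℂ), s] f
  rw [hf, map_zero, Fin.sum_univ_two, ← hFx, ← hFy] at hchain
  simp only [Matrix.cons_val_zero, Matrix.cons_val_one, derivative_X, mul_one] at hchain
  have hFx' : PowerSeries.X * Fx = -((PowerSeries.X * d⁄dX ℂ s) * Fy) := by
    linear_combination -PowerSeries.X * hchain
  have hsFy : (s * Fy).order = (M : ℕ∞) + Fy.order := by rw [order_mul, hord]
  refine ⟨⟨?_, hsFy⟩, ?_⟩
  · rw [hsFy, hFx', order_neg, order_mul, order_X_mul_derivative (by lia) hord]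
  · have hfactor : (M : PowerSeries ℂ) * (s * Fy) + PowerSeries.X * Fx =
        ((M : PowerSeries ℂ) * s - PowerSeries.X * d⁄dX ℂ s) * Fy := by
      rw [hFx']
      ring
    rw [hfactor, order_mul]
    exact (ENat.add_lt_add_iff_right (order_eq_top.not.mpr hFy0)).mpr
      (lt_order_natCast_mul_sub_X_mul_derivative hord)
end
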